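/- arXiv:0802.0118 — 3 statements merged into one kernel-verified Lean document; each statement's English description precedes it below -/
import Mathlib

section
/- If G is a free group of finite rank and φ : G → G is an injective homomorphism, then the ascending HNN extension G_φ is highly residually finite. -/
/-- A group `G` is residually finite if every nontrivial element avoids some
finite-index normal subgroup. -/
def ResiduallyFinite (G : Type*) [Group G] : Prop :=
  ∀ g : G, g ≠ 1 → ∃ N : Subgroup G, N.Normal ∧ N.FiniteIndex ∧ g ∉ N

/-- A group `Q` is highly residually finite if for every group extension
`1 → F → E → Q → 1` with `F` finite, the group `E` is residually finite. -/
def HighlyResiduallyFinite (Q : Type*) [Group Q] : Prop :=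
  ∀ (E F : Type*) [Group E] [Group F], Finite F →
    ∀ (ι : F →* E) (π : E →* Q), Function.Injective ι → Function.Surjective π →
      π.ker = ι.range → ResiduallyFinite E

/-- The ascending HNN extension of `G` with respect to an injective endomorphism `φ`:
the group `⟨G, t | t⁻¹ g t = φ(g) for all g ∈ G⟩`, realized as the HNN extension of `G`
with associated subgroups `φ.range` and `⊤` (so that `t⁻¹ (of g) t = of (φ g)`). -/
noncomputable abbrev AscendingHNNExtension {G : Type*} [Group G] (φ : G →* G)
    (hφ : Function.Injective φ) : Type _ :=
  HNNExtension G φ.range ⊤ ((MonoidHom.ofInjective hφ).symm.trans Subgroup.topEquiv.symm)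

namespace MvPolynomial

section DegreeFiltration

variable {σ R : Type*} [CommRing R]

/-- The polynomials all of whose monomials have degree less than `d`. -/
noncomputable def degreeLT (σ R : Type*) [CommRing R] (d : ℕ) : Submodule R (MvPolynomial σ R) :=
  restrictSupport R {s | s.degree < d}

theorem mem_degreeLT {d : ℕ} {g : MvPolynomial σ R} :
    g ∈ degreeLT σ R d ↔ ∀ s ∈ g.support, s.degree < d := by
  rw [degreeLT, mem_restrictSupport_iff]; rfl

theorem degreeLT_mono {d e : ℕ} (h : d ≤ e) : degreeLT σ R d ≤ degreeLT σ R e :=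
  fun _ hg => mem_degreeLT.2 fun s hs => (mem_degreeLT.1 hg s hs).trans_le h

theorem mem_degreeLT_of_totalDegree_lt {d : ℕ} {g : MvPolynomial σ R} (h : g.totalDegree < d) :
    g ∈ degreeLT σ R d :=
  mem_degreeLT.2 fun _ hs => (le_totalDegree hs).trans_lt h

theorem eq_zero_of_mem_degreeLT_zero {g : MvPolynomial σ R} (hg : g ∈ degreeLT σ R 0) :
    g = 0 := by
  rw [← support_eq_empty, Finset.eq_empty_iff_forall_notMem]
  exact fun s hs => Nat.not_lt_zero _ (mem_degreeLT.1 hg s hs)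

theorem mul_mem_degreeLT {d e : ℕ} {g h : MvPolynomial σ R} (hg : g ∈ degreeLT σ R d)
    (hh : h ∈ degreeLT σ R (e + 1)) : g * h ∈ degreeLT σ R (d + e) := by
  classical
  rw [mem_degreeLT] at *
  intro s hs
  obtain ⟨a, ha, b, hb, rfl⟩ := Finset.mem_add.1 (support_mul g h hs)
  have := hg a ha
  have := hh b hb
  rw [map_add]
  omega

/-- `a` has leading form `b`, which is homogeneous of degree at most `d`. -/
def HasLeading (a b : MvPolynomial σ R) (d : ℕ) : Prop :=
  a - b ∈ degreeLT σ R d ∧ b ∈ degreeLT σ R (d + 1)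

theorem HasLeading.mul {a b a' b' : MvPolynomial σ R} {d d' : ℕ} (h : HasLeading a b d)
    (h' : HasLeading a' b' d') : HasLeading (a * a') (b * b') (d + d') := by
  have ha' : a' ∈ degreeLT σ R (d' + 1) := by
    have := add_mem (degreeLT_mono d'.le_succ h'.1) h'.2
    simpa using this
  refine ⟨?_, ?_⟩
  · have e : a * a' - b * b' = (a - b) * a' + (a' - b') * b := by ring
    rw [e]
    refine add_mem (mul_mem_degreeLT h.1 ha') ?_
    rw [add_comm d]
    exact mul_mem_degreeLT h'.1 h.2
  · have := mul_mem_degreeLT h.2 h'.2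
    rwa [add_right_comm] at this

theorem hasLeading_self {b : MvPolynomial σ R} {d : ℕ} (h : b ∈ degreeLT σ R (d + 1)) :
    HasLeading b b d :=
  ⟨by simp, h⟩

theorem monomial_mem_degreeLT {s : σ →₀ ℕ} {d : ℕ} (r : R) (h : s.degree < d) :
    monomial s r ∈ degreeLT σ R d := by
  classical
  rw [mem_degreeLT]
  intro u hu
  rwa [Finset.mem_singleton.1 (support_monomial_subset hu)]

theorem hasLeading_one : HasLeading (1 : MvPolynomial σ R) 1 0 :=
  hasLeading_self (monomial_mem_degreeLT 1 (by simp))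

theorem HasLeading.pow {a b : MvPolynomial σ R} {d : ℕ} (h : HasLeading a b d) (n : ℕ) :
    HasLeading (a ^ n) (b ^ n) (n * d) := by
  induction n with
  | zero => simpa using hasLeading_one
  | succ n ih => rw [pow_succ, pow_succ, add_mul, one_mul]; exact ih.mul h

theorem HasLeading.prod {ι : Type*} (s : Finset ι) {a b : ι → MvPolynomial σ R} {d : ι → ℕ}
    (h : ∀ i, HasLeading (a i) (b i) (d i)) :
    HasLeading (∏ i ∈ s, a i) (∏ i ∈ s, b i) (∑ i ∈ s, d i) := by
  classical
  induction s using Finset.induction_on with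
  | empty => simpa using hasLeading_one
  | insert i s hi ih =>
    rw [Finset.prod_insert hi, Finset.prod_insert hi, Finset.sum_insert hi]
    exact (h i).mul ih

end DegreeFiltration

section LowDegree

variable {σ R : Type*} [Fintype σ] [CommRing R]

/-- The monomial `X ^ s` with each `X i ^ Q` replaced by `Y i`. -/
noncomputable def twistedMonomial (Q : ℕ) (Y : σ → MvPolynomial σ R) (s : σ →₀ ℕ) :
    MvPolynomial σ R :=
  monomial (s.mapRange (· % Q) (Nat.zero_mod Q)) 1 * ∏ i, Y i ^ (s i / Q)

/-- The linear map replacing each monomial by its twisted version. -/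
noncomputable def twist (Q : ℕ) (Y : σ → MvPolynomial σ R) :
    MvPolynomial σ R →ₗ[R] MvPolynomial σ R :=
  (basisMonomials σ R).constr R (twistedMonomial Q Y)

theorem twist_monomial (Q : ℕ) (Y : σ → MvPolynomial σ R) (s : σ →₀ ℕ) :
    twist Q Y (monomial s 1) = twistedMonomial Q Y s := by
  have h := (basisMonomials σ R).constr_basis R (twistedMonomial Q Y) s
  rwa [coe_basisMonomials] at h

theorem twistedMonomial_X_pow (Q : ℕ) (s : σ →₀ ℕ) :
    twistedMonomial (R := R) Q (fun i => X i ^ Q) s = monomial s 1 := by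
  have h : ∏ i, ((X i : MvPolynomial σ R) ^ Q) ^ (s i / Q) =
      monomial (s.mapRange (fun m => Q * (m / Q)) (by simp)) 1 := by
    rw [monomial_eq, C_1, one_mul, Finsupp.prod_fintype _ _ (by simp)]
    simp [pow_mul]
  rw [twistedMonomial, h, monomial_mul, one_mul]
  have e : s.mapRange (· % Q) (Nat.zero_mod Q) +
      s.mapRange (fun m => Q * (m / Q)) (by simp) = s := by
    ext i
    simp [Nat.mod_add_div]
  rw [e]

variable {Q : ℕ} {Y : σ → MvPolynomial σ R}

theorem twistedMonomial_sub_mem (hY : ∀ i, HasLeading (Y i) (X i ^ Q) Q) (s : σ →₀ ℕ) :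
    twistedMonomial Q Y s - monomial s 1 ∈ degreeLT σ R s.degree := by
  rw [← twistedMonomial_X_pow Q s]
  have h1 := HasLeading.prod Finset.univ fun i => (hY i).pow (s i / Q)
  have h2 := hasLeading_self (monomial_mem_degreeLT (1 : R)
    (Nat.lt_succ_self (s.mapRange (· % Q) (Nat.zero_mod Q)).degree))
  refine degreeLT_mono (le_of_eq ?_) (h2.mul h1).1
  simp [Finsupp.degree_eq_sum, ← Finset.sum_add_distrib, mul_comm _ Q, Nat.mod_add_div]

theorem twist_sub_mem (hY : ∀ i, HasLeading (Y i) (X i ^ Q) Q) {d : ℕ} {g : MvPolynomial σ R}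
    (hg : g ∈ degreeLT σ R (d + 1)) : twist Q Y g - g ∈ degreeLT σ R d := by
  have e : twist Q Y g - g =
      ∑ s ∈ g.support, coeff s g • (twistedMonomial Q Y s - monomial s 1) := by
    conv_lhs => rw [g.as_sum]
    rw [map_sum, ← Finset.sum_sub_distrib]
    refine Finset.sum_congr rfl fun s _ => ?_
    rw [← twist_monomial, smul_sub, ← map_smul, smul_monomial, smul_eq_mul, mul_one]
  rw [e]
  exact sum_mem fun s hs => Submodule.smul_mem _ _
    (degreeLT_mono (Nat.lt_succ_iff.1 (mem_degreeLT.1 hg s hs)) (twistedMonomial_sub_mem hY s))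

theorem twist_injective (hY : ∀ i, HasLeading (Y i) (X i ^ Q) Q) :
    Function.Injective (twist Q Y) := by
  rw [injective_iff_map_eq_zero]
  intro g hg
  have key : ∀ d, g ∈ degreeLT σ R d → g = 0 := by
    intro d
    induction d with
    | zero => exact eq_zero_of_mem_degreeLT_zero
    | succ d ih =>
      intro h
      have := twist_sub_mem hY h
      rw [hg, zero_sub, neg_mem_iff] at this
      exact ih this
  exact key _ (mem_degreeLT_of_totalDegree_lt (Nat.lt_succ_self _))

theorem twist_surjective (hY : ∀ i, HasLeading (Y i) (X i ^ Q) Q) :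
    Function.Surjective (twist Q Y) := by
  have key : ∀ d, ∀ g ∈ degreeLT σ R d, ∃ h, twist Q Y h = g := by
    intro d
    induction d with
    | zero => exact fun g hg => ⟨0, by rw [map_zero, eq_zero_of_mem_degreeLT_zero hg]⟩
    | succ d ih =>
      intro g hg
      obtain ⟨h, hh⟩ := ih _ (twist_sub_mem hY hg)
      exact ⟨g - h, by rw [map_sub, hh, sub_sub_cancel]⟩
  exact fun g => key _ g (mem_degreeLT_of_totalDegree_lt (Nat.lt_succ_self _))

theorem twist_X_pow_mul (hQ : 0 < Q) (i : σ) (g : MvPolynomial σ R) :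
    twist Q Y (X i ^ Q * g) = Y i * twist Q Y g := by
  classical
  induction g using MvPolynomial.induction_on' with
  | add p q hp hq => rw [mul_add, map_add, hp, hq, map_add, mul_add]
  | monomial s r =>
    have e : monomial s r = r • monomial s (1 : R) := by
      rw [smul_monomial, smul_eq_mul, mul_one]
    rw [e, mul_smul_comm, map_smul, map_smul, mul_smul_comm, X_pow_eq_monomial,
      monomial_mul, one_mul, twist_monomial, twist_monomial]
    congr 1
    have h1 : (Finsupp.single i Q + s).mapRange (· % Q) (Nat.zero_mod Q) =
        s.mapRange (· % Q) (Nat.zero_mod Q) := by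
      ext j
      by_cases hj : i = j
      · subst hj; simp
      · simp [hj]
    have h2 : ∀ j, Y j ^ ((Finsupp.single i Q + s) j / Q) =
        (if j = i then Y j else 1) * Y j ^ (s j / Q) := by
      intro j
      by_cases hj : j = i
      · subst hj
        simp [Nat.add_div_left _ hQ, pow_succ']
      · simp [hj]
    rw [twistedMonomial, twistedMonomial, h1, Finset.prod_congr rfl fun j _ => h2 j,
      Finset.prod_mul_distrib, Finset.prod_ite_eq' Finset.univ i]
    simp only [Finset.mem_univ, if_true]
    ring

/-- The ideal generated by `X i ^ Q - f i`, where `f i` has total degree less than `Q`,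
contains no nonzero polynomial of total degree less than `Q`. -/
theorem eq_zero_of_mem_span_X_pow_sub {f : σ → MvPolynomial σ R} {Q : ℕ}
    (hf : ∀ i, (f i).totalDegree < Q) {P : MvPolynomial σ R} (hP : P.totalDegree < Q)
    (h : P ∈ Ideal.span (Set.range fun i => X i ^ Q - f i)) : P = 0 := by
  classical
  have hQ : 0 < Q := (Nat.zero_le _).trans_lt hP
  set Y : σ → MvPolynomial σ R := fun i => X i ^ Q - f i with hYdef
  have hY : ∀ i, HasLeading (Y i) (X i ^ Q) Q := fun i => by
    refine ⟨?_, ?_⟩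
    · rw [hYdef]
      simpa using mem_degreeLT_of_totalDegree_lt (hf i)
    · rw [X_pow_eq_monomial]
      exact monomial_mem_degreeLT _ (by simp)
  obtain ⟨c, hc⟩ := Ideal.mem_span_range_iff_exists_fun.1 h
  choose c' hc' using fun i => twist_surjective hY (c i)
  have hlow : ∀ s ∈ P.support, ∀ i, s i < Q := fun s hs i =>
    (Finsupp.le_degree i s).trans_lt ((le_totalDegree hs).trans_lt hP)
  have h1 : twist Q Y P = P := by
    conv_lhs => rw [P.as_sum]
    conv_rhs => rw [P.as_sum]
    rw [map_sum]
    refine Finset.sum_congr rfl fun s hs => ?_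
    have e : twistedMonomial Q Y s = monomial s 1 := by
      have : s.mapRange (· % Q) (Nat.zero_mod Q) = s := by
        ext i
        simp [Nat.mod_eq_of_lt (hlow s hs i)]
      simp [twistedMonomial, this, Nat.div_eq_of_lt (hlow s hs _)]
    rw [← mul_one (coeff s P), ← smul_eq_mul, ← smul_monomial, map_smul, twist_monomial, e]
  have h2 : twist Q Y (∑ i, X i ^ Q * c' i) = P := by
    rw [map_sum, ← hc]
    exact Finset.sum_congr rfl fun i _ => by rw [twist_X_pow_mul hQ, hc', mul_comm]
  have h3 : P = ∑ i, X i ^ Q * c' i := twist_injective hY (h1.trans h2.symm)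
  rw [← support_eq_empty, Finset.eq_empty_iff_forall_notMem]
  intro s hs
  refine mem_support_iff.1 hs ?_
  rw [h3, coeff_sum]
  refine Finset.sum_eq_zero fun i _ => ?_
  rw [X_pow_eq_monomial, coeff_monomial_mul', if_neg]
  intro hle
  have := hle i
  rw [Finsupp.single_eq_same] at this
  exact absurd (hlow s hs i) (by omega)

end LowDegree

section Kronecker

variable {R : Type*} [CommRing R]

theorem aeval_X_pow_pow_eq_sum {N Q : ℕ} (h : MvPolynomial (Fin N) R) :
    aeval (fun j : Fin N => (Polynomial.X : Polynomial R) ^ Q ^ (j : ℕ)) h =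
      ∑ s ∈ h.support, Polynomial.monomial (∑ j, s j * Q ^ (j : ℕ)) (coeff s h) := by
  rw [aeval_def, eval₂_eq']
  refine Finset.sum_congr rfl fun s _ => ?_
  rw [← Polynomial.C_mul_X_pow_eq_monomial, ← Finset.prod_pow_eq_pow_sum]
  simp_rw [← pow_mul, mul_comm]
  rfl

/-- Kronecker substitution is injective on polynomials of total degree less than `Q`. -/
theorem aeval_X_pow_pow_ne_zero {N Q : ℕ} {h : MvPolynomial (Fin N) R} (h0 : h ≠ 0)
    (hQ : h.totalDegree < Q) :
    aeval (fun j : Fin N => (Polynomial.X : Polynomial R) ^ Q ^ (j : ℕ)) h ≠ 0 := by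
  have hlt : ∀ s ∈ h.support, ∀ j, s j < Q := fun s hs j =>
    (Finsupp.le_degree j s).trans_lt ((le_totalDegree hs).trans_lt hQ)
  obtain ⟨s, hs⟩ := Finset.nonempty_of_ne_empty (mt support_eq_empty.1 h0)
  intro hz
  have hc := congrArg (Polynomial.coeff · (∑ j, s j * Q ^ (j : ℕ))) hz
  rw [aeval_X_pow_pow_eq_sum] at hc
  simp only [Polynomial.finsetSum_coeff, Polynomial.coeff_zero] at hc
  rw [Finset.sum_eq_single s] at hc
  · rw [Polynomial.coeff_monomial_same] at hc
    exact mem_support_iff.1 hs hc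
  · intro u hu hus
    rw [Polynomial.coeff_monomial, if_neg]
    intro he
    apply hus
    have h1 := finFunctionFinEquiv_apply fun j => (⟨u j, hlt u hu j⟩ : Fin Q)
    have h2 := finFunctionFinEquiv_apply fun j => (⟨s j, hlt s hs j⟩ : Fin Q)
    have h3 := finFunctionFinEquiv.injective (Fin.ext (h1.trans (he.trans h2.symm)))
    ext j
    exact congrArg Fin.val (congrFun h3 j)
  · exact fun h => absurd hs h

theorem natDegree_aeval_X_pow_pow_le {n Q : ℕ} (hQ : 0 < Q) (h : MvPolynomial (Fin (n + 1)) R) :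
    (aeval (fun j : Fin (n + 1) => (Polynomial.X : Polynomial R) ^ Q ^ (j : ℕ)) h).natDegree ≤
      h.totalDegree * Q ^ n := by
  rw [aeval_X_pow_pow_eq_sum]
  refine Polynomial.natDegree_sum_le_of_forall_le _ _ fun s hs =>
    (Polynomial.natDegree_monomial_le _).trans ?_
  calc ∑ j, s j * Q ^ (j : ℕ) ≤ ∑ j, s j * Q ^ n := by
        gcongr with j
        exact j.is_le
    _ = s.degree * Q ^ n := by rw [← Finset.sum_mul, Finsupp.degree_eq_sum]
    _ ≤ _ := Nat.mul_le_mul_right _ (le_totalDegree hs)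

end Kronecker

theorem exists_aeval_eq_zero {F σ : Type*} [Field F] [Fintype σ]
    (g : Fin (Fintype.card σ + 1) → MvPolynomial σ F) :
    ∃ h : MvPolynomial _ F, h ≠ 0 ∧ aeval g h = 0 := by
  by_contra! hne
  have hi : AlgebraicIndependent F g := algebraicIndependent_iff.2 fun h hh => by
    by_contra h0
    exact hne h h0 hh
  have := hi.lift_cardinalMk_le_trdeg
  rw [trdeg_of_isDomain] at this
  simp only [Cardinal.mk_fintype, Fintype.card_fin, Cardinal.lift_natCast] at this
  exact absurd (Nat.cast_le.1 this) (by omega)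

theorem totalDegree_map_le {R S σ : Type*} [CommSemiring R] [CommSemiring S] (φ : R →+* S)
    (g : MvPolynomial σ R) : (map φ g).totalDegree ≤ g.totalDegree :=
  Finset.sup_mono (support_map_subset φ g)

section QuasiFixed

variable {p : ℕ} [Fact p.Prime] {σ : Type*} {f : σ → MvPolynomial σ (ZMod p)}

theorem aeval_bind₁_iterate_eq_pow {R : Type*} [CommRing R] [Algebra (ZMod p) R] [CharP R p]
    {x : σ → R} {m : ℕ} (hx : ∀ i, aeval x (f i) = x i ^ p ^ m) (j : ℕ)
    (g : MvPolynomial σ (ZMod p)) :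
    aeval x ((bind₁ f)^[j] g) = aeval x g ^ (p ^ m) ^ j := by
  have key : ∀ g, aeval x (bind₁ f g) = aeval x g ^ p ^ m := by
    intro g
    have h : ((aeval x).comp (bind₁ f) : MvPolynomial σ (ZMod p) →ₐ[ZMod p] R).toRingHom =
        (iterateFrobenius R p m).comp (aeval x : _ →ₐ[ZMod p] R).toRingHom := by
      refine MvPolynomial.ringHom_ext' (Subsingleton.elim _ _) fun i => ?_
      simp [iterateFrobenius_def, hx]
    exact congrArg (fun φ : MvPolynomial σ (ZMod p) →+* R => φ g) h
  induction j generalizing g with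
  | zero => simp
  | succ j ih => rw [Function.iterate_succ_apply, ih, key, ← pow_mul, pow_succ']

theorem aeval_mem_span_sub {K R : Type*} [Field K] [Algebra (ZMod p) K] [CommRing R]
    [Algebra (ZMod p) R] [Algebra K R] [IsScalarTower (ZMod p) K R] (x : σ → R) {a : σ → K}
    {D : MvPolynomial σ (ZMod p)} (hD : aeval a D = 0) :
    aeval x D ∈ Ideal.span (Set.range fun i => x i - algebraMap K R (a i)) := by
  set J := Ideal.span (Set.range fun i => x i - algebraMap K R (a i)) with hJ
  rw [← Ideal.Quotient.eq_zero_iff_mem]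
  have h1 : ∀ i, Ideal.Quotient.mk J (x i) = algebraMap K (R ⧸ J) (a i) := fun i => by
    rw [← sub_eq_zero, IsScalarTower.algebraMap_apply K R (R ⧸ J), Ideal.Quotient.algebraMap_eq,
      ← map_sub, Ideal.Quotient.eq_zero_iff_mem]
    exact Ideal.subset_span ⟨i, rfl⟩
  have h2 : Ideal.Quotient.mk J (aeval x D) =
      aeval (fun i => Ideal.Quotient.mk J (x i)) D := by
    rw [← Ideal.Quotient.mkₐ_eq_mk (ZMod p), comp_aeval_apply]
  rw [h2]
  simp_rw [h1]
  have h3 := aeval_algebraMap_apply (R := ZMod p) (R ⧸ J) a D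
  rw [hD, map_zero] at h3
  exact h3

/-- If `x` solves `f i = x i ^ q` in a `K`-algebra and `D` vanishes at `a`, then a power of
`D ∘ f^[n]`, with exponent independent of `q`, is killed by an element which does not vanish
at `a`. -/
theorem exists_aeval_iterate_mul_eq_zero [Fintype σ] {K R : Type*} [Field K]
    [Algebra (ZMod p) K] [CommRing R] [CharP R p] [Algebra (ZMod p) R] [Algebra K R]
    [IsScalarTower (ZMod p) K R] {n c m : ℕ} {h : σ → MvPolynomial (Fin (n + 1)) (ZMod p)}
    (h0 : ∀ i, h i ≠ 0) (hh : ∀ i, aeval (fun j : Fin (n + 1) => (bind₁ f)^[j] (X i)) (h i) = 0)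
    (hc : ∀ i, (h i).totalDegree ≤ p ^ c) (hm : ∀ i, (h i).totalDegree < p ^ m)
    {x : σ → R} (hx : ∀ i, aeval x (f i) = x i ^ p ^ m) {a : σ → K}
    {D : MvPolynomial σ (ZMod p)} (hD : aeval a D = 0) :
    ∃ u : σ → Polynomial K, (∀ i, (u i).eval (a i) ≠ 0) ∧
      aeval x (((bind₁ f)^[n] D) ^ p ^ c) * ∏ i, Polynomial.aeval (x i) (u i) = 0 := by
  classical
  have hp : 0 < p ^ m := Nat.pow_pos (Fact.out : p.Prime).pos
  have key : ∀ i, ∃ u : Polynomial K, u.eval (a i) ≠ 0 ∧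
      (x i - algebraMap K R (a i)) ^ p ^ (m * n + c) * Polynomial.aeval (x i) u = 0 := by
    intro i
    set H := aeval (fun j : Fin (n + 1) => (Polynomial.X : Polynomial (ZMod p)) ^
      (p ^ m) ^ (j : ℕ)) (h i) with hH
    have hH0 : H.map (algebraMap (ZMod p) K) ≠ 0 :=
      (Polynomial.map_ne_zero_iff (algebraMap (ZMod p) K).injective).2
        (aeval_X_pow_pow_ne_zero (h0 i) (hm i))
    have hHx : Polynomial.aeval (x i) (H.map (algebraMap (ZMod p) K)) = 0 := by
      rw [Polynomial.aeval_map_algebraMap, hH, comp_aeval_apply]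
      have := congrArg (aeval x) (hh i)
      rw [comp_aeval_apply, map_zero] at this
      rw [← this]
      congr 2
      ext j
      simp [aeval_bind₁_iterate_eq_pow hx]
    obtain ⟨u, hu, hdvd⟩ := Polynomial.exists_eq_pow_rootMultiplicity_mul_and_not_dvd _ hH0 (a i)
    refine ⟨u, fun h => hdvd (Polynomial.dvd_iff_isRoot.2 h), ?_⟩
    have hle : Polynomial.rootMultiplicity (a i) (H.map (algebraMap (ZMod p) K)) ≤
        p ^ (m * n + c) := by
      have hd := Polynomial.natDegree_le_of_dvd (Polynomial.pow_rootMultiplicity_dvd _ (a i)) hH0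
      rw [Polynomial.natDegree_pow, Polynomial.natDegree_X_sub_C, mul_one,
        Polynomial.natDegree_map] at hd
      refine hd.trans ?_
      refine (natDegree_aeval_X_pow_pow_le hp (h i)).trans ?_
      rw [pow_add, pow_mul, mul_comm]
      exact Nat.mul_le_mul_left _ (hc i)
    rw [hu, map_mul, map_pow, map_sub, Polynomial.aeval_X, Polynomial.aeval_C] at hHx
    rw [← Nat.sub_add_cancel hle, pow_add, mul_assoc, hHx, mul_zero]
  choose u hu hxu using key
  refine ⟨u, hu, ?_⟩
  obtain ⟨r, hr⟩ := Ideal.mem_span_range_iff_exists_fun.1 (aeval_mem_span_sub x hD)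
  rw [map_pow, aeval_bind₁_iterate_eq_pow hx, ← pow_mul p, ← pow_mul, ← pow_add, ← hr,
    sum_pow_char_pow, Finset.sum_mul]
  refine Finset.sum_eq_zero fun i _ => ?_
  rw [← Finset.mul_prod_erase _ _ (Finset.mem_univ i), mul_pow, mul_assoc,
    ← mul_assoc ((x i - algebraMap K R (a i)) ^ _), hxu, zero_mul, mul_zero]

/-- A polynomial self-map `f` of affine space over `ZMod p` has points with `f x = Frob x`, for
some power of Frobenius, outside every hypersurface not containing the `n`-th iterated image,
where `n` is the dimension. -/
theorem exists_quasiFixed [Fintype σ] {D : MvPolynomial σ (ZMod p)}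
    (hD : (bind₁ f)^[Fintype.card σ] D ≠ 0) :
    ∃ (a : σ → AlgebraicClosure (ZMod p)) (m : ℕ), (∀ i, aeval a (f i) = a i ^ p ^ m) ∧
      aeval a D ≠ 0 := by
  set K := AlgebraicClosure (ZMod p)
  set n := Fintype.card σ
  have hp1 : 1 < p := (Fact.out : p.Prime).one_lt
  choose h h0 hh using fun i : σ =>
    exists_aeval_eq_zero fun j : Fin (n + 1) => (bind₁ f)^[j] (X i)
  set c := ∑ i, (h i).totalDegree with hc
  have hhc : ∀ i, (h i).totalDegree ≤ c := fun i =>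
    Finset.single_le_sum (f := fun i => (h i).totalDegree) (fun _ _ => Nat.zero_le _)
      (Finset.mem_univ i)
  set P := ((bind₁ f)^[n] D) ^ p ^ c with hP
  have hP0 : P ≠ 0 := pow_ne_zero _ hD
  set m := c + P.totalDegree + ∑ i, (f i).totalDegree with hm
  have hpm : m < p ^ m := Nat.lt_pow_self hp1
  have hfm : ∀ i, (f i).totalDegree ≤ ∑ i, (f i).totalDegree := fun i =>
    Finset.single_le_sum (f := fun i => (f i).totalDegree) (fun _ _ => Nat.zero_le _)
      (Finset.mem_univ i)
  have hinj := (algebraMap (ZMod p) K).injective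
  set I : Ideal (MvPolynomial σ K) :=
    Ideal.span (Set.range fun i => X i ^ p ^ m - map (algebraMap (ZMod p) K) (f i)) with hI
  have hPI : map (algebraMap (ZMod p) K) P ∉ I := by
    intro hmem
    refine hP0 (map_injective _ hinj ?_)
    rw [map_zero]
    refine eq_zero_of_mem_span_X_pow_sub (fun i => ?_) ?_ hmem
    · refine (totalDegree_map_le _ _).trans_lt ?_
      have := hfm i
      omega
    · refine (totalDegree_map_le _ _).trans_lt ?_
      omega
  set J := Submodule.colon I {map (algebraMap (ZMod p) K) P} with hJ
  have hJtop : J ≠ ⊤ := fun ht => hPI <| by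
    have : (1 : MvPolynomial σ K) ∈ J := ht ▸ Submodule.mem_top
    rw [hJ, Submodule.mem_colon_singleton] at this
    simpa using this
  obtain ⟨M, hM, hJM⟩ := Ideal.exists_le_maximal J hJtop
  obtain ⟨a, rfl⟩ := isMaximal_iff_eq_vanishingIdeal_singleton.1 hM
  have hev : ∀ g ∈ J, aeval a g = 0 := fun g hg =>
    (mem_vanishingIdeal_singleton_iff a g).1 (hJM hg)
  refine ⟨a, m, fun i => ?_, fun hDa => ?_⟩
  · have hmem : X i ^ p ^ m - map (algebraMap (ZMod p) K) (f i) ∈ J := by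
      rw [hJ, Submodule.mem_colon_singleton, smul_eq_mul]
      exact I.mul_mem_right _ (Ideal.subset_span ⟨i, rfl⟩)
    have := hev _ hmem
    rw [map_sub, map_pow, aeval_X, aeval_map_algebraMap, sub_eq_zero] at this
    exact this.symm
  · have hItop : I ≠ ⊤ := fun ht => hPI (ht ▸ Submodule.mem_top)
    have : Nontrivial (MvPolynomial σ K ⧸ I) := Ideal.Quotient.nontrivial_iff.2 hItop
    have : CharP (MvPolynomial σ K ⧸ I) p :=
      charP_of_injective_algebraMap (algebraMap (ZMod p) _).injective p
    have haev : ∀ g : MvPolynomial σ (ZMod p),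
        aeval (fun i => Ideal.Quotient.mk I (X i)) g =
          Ideal.Quotient.mk I (map (algebraMap (ZMod p) K) g) := by
      intro g
      have e := comp_aeval_apply (X : σ → MvPolynomial σ K) (Ideal.Quotient.mkₐ (ZMod p) I) g
      rw [← aeval_map_algebraMap K, aeval_X_left_apply] at e
      exact e.symm
    have hx : ∀ i, aeval (fun i => Ideal.Quotient.mk I (X i)) (f i) =
        (Ideal.Quotient.mk I (X i)) ^ p ^ m := by
      intro i
      rw [haev, eq_comm, ← map_pow, ← sub_eq_zero, ← map_sub, Ideal.Quotient.eq_zero_iff_mem]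
      exact Ideal.subset_span ⟨i, rfl⟩
    obtain ⟨u, hu, huz⟩ := exists_aeval_iterate_mul_eq_zero h0 hh
      (fun i => (hhc i).trans (Nat.lt_pow_self hp1).le)
      (fun i => by have := hhc i; omega) hx hDa
    have hmem : ∏ i, Polynomial.aeval (X i : MvPolynomial σ K) (u i) ∈ J := by
      rw [hJ, Submodule.mem_colon_singleton, smul_eq_mul, ← Ideal.Quotient.eq_zero_iff_mem,
        map_mul, ← haev, mul_comm, map_prod]
      rw [← huz]
      congr 2
      ext i
      exact (Polynomial.aeval_algHom_apply (Ideal.Quotient.mkₐ K I) _ _).symm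
    have := hev _ hmem
    rw [map_prod, Finset.prod_eq_zero_iff] at this
    obtain ⟨i, -, hi⟩ := this
    rw [← Polynomial.aeval_algHom_apply, aeval_X] at hi
    exact hu i hi

end QuasiFixed

end MvPolynomial

section WordMaps

open Matrix

variable {ι R S : Type*} [CommRing R] [CommRing S]

/-- The value of a word at a tuple of `2 × 2` matrices, with adjugates in place of inverses. -/
def wordMatrix (A : ι → Matrix (Fin 2) (Fin 2) R) (L : List (ι × Bool)) :
    Matrix (Fin 2) (Fin 2) R :=
  (L.map fun x => cond x.2 (A x.1) (adjugate (A x.1))).prod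

theorem wordMatrix_cons (A : ι → Matrix (Fin 2) (Fin 2) R) (x : ι × Bool)
    (L : List (ι × Bool)) :
    wordMatrix A (x :: L) = cond x.2 (A x.1) (adjugate (A x.1)) * wordMatrix A L := by
  simp [wordMatrix]

theorem wordMatrix_map (φ : R →+* S) (A : ι → Matrix (Fin 2) (Fin 2) R) (L : List (ι × Bool)) :
    wordMatrix (fun i => φ.mapMatrix (A i)) L = φ.mapMatrix (wordMatrix A L) := by
  induction L with
  | nil => simp [wordMatrix]
  | cons x L ih =>
    rw [wordMatrix_cons, wordMatrix_cons, map_mul, ih]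
    obtain ⟨i, _ | _⟩ := x
    · rw [cond_false, cond_false, RingHom.map_adjugate]
    · rfl

/-- The value of a word at a tuple of elements of `GL₂`, with adjugates in place of inverses. -/
noncomputable def wordGL (A : ι → GL (Fin 2) R) (L : List (ι × Bool)) : GL (Fin 2) R :=
  (L.map fun x => cond x.2 (A x.1)
    (GeneralLinearGroup.scalar (Fin 2) (GeneralLinearGroup.det (A x.1)) * (A x.1)⁻¹)).prod

theorem wordGL_cons (A : ι → GL (Fin 2) R) (x : ι × Bool) (L : List (ι × Bool)) :
    wordGL A (x :: L) = cond x.2 (A x.1)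
      (GeneralLinearGroup.scalar (Fin 2) (GeneralLinearGroup.det (A x.1)) * (A x.1)⁻¹) *
        wordGL A L := by
  simp [wordGL]

theorem coe_wordGL (A : ι → GL (Fin 2) R) (L : List (ι × Bool)) :
    (wordGL A L : Matrix (Fin 2) (Fin 2) R) = wordMatrix (fun i => A i) L := by
  induction L with
  | nil => simp [wordGL, wordMatrix]
  | cons x L ih =>
    rw [wordGL_cons, wordMatrix_cons, Units.val_mul, ih]
    obtain ⟨i, _ | _⟩ := x
    · congr 1
      rw [cond_false, cond_false, Units.val_mul]
      rw [Units.mul_inv_eq_iff_eq_mul, adjugate_mul, smul_one_eq_diagonal]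
      rfl
    · rfl

/-- The projective linear group of degree two. -/
abbrev PGL₂ (R : Type*) [CommRing R] : Type _ :=
  GL (Fin 2) R ⧸ Subgroup.center (GL (Fin 2) R)

/-- The projective representation of the free group given by a tuple of matrices. -/
noncomputable def projRep (A : ι → GL (Fin 2) R) : FreeGroup ι →* PGL₂ R :=
  FreeGroup.lift fun i => (A i : PGL₂ R)

theorem mk_wordGL (A : ι → GL (Fin 2) R) (L : List (ι × Bool)) :
    (wordGL A L : PGL₂ R) = projRep A (FreeGroup.mk L) := by
  induction L with
  | nil => simp [wordGL, ← FreeGroup.one_eq_mk]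
  | cons x L ih =>
    have e : FreeGroup.mk (x :: L) = FreeGroup.mk [x] * FreeGroup.mk L := by
      rw [FreeGroup.mul_mk, List.singleton_append]
    rw [wordGL_cons, e, map_mul, ← ih, QuotientGroup.mk_mul]
    congr 1
    obtain ⟨i, _ | _⟩ := x
    · have hs : ((GeneralLinearGroup.scalar (Fin 2) (GeneralLinearGroup.det (A i)) :
          GL (Fin 2) R) : PGL₂ R) = 1 := by
        rw [QuotientGroup.eq_one_iff, GeneralLinearGroup.center_eq_range_scalar]
        exact ⟨_, rfl⟩
      simp [projRep, hs]
    · simp [projRep]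

/-- The self-map of tuples in `GL₂` induced by an endomorphism of the free group. -/
noncomputable def endoGL [DecidableEq ι] (φ : FreeGroup ι →* FreeGroup ι) (A : ι → GL (Fin 2) R)
    (i : ι) : GL (Fin 2) R :=
  wordGL A (φ (FreeGroup.of i)).toWord

theorem projRep_endoGL [DecidableEq ι] (φ : FreeGroup ι →* FreeGroup ι) (A : ι → GL (Fin 2) R) :
    projRep (endoGL φ A) = (projRep A).comp φ := by
  ext i
  have h := mk_wordGL A (φ (FreeGroup.of i)).toWord
  rw [FreeGroup.mk_toWord] at h
  rw [MonoidHom.comp_apply, ← h]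
  simp [projRep, endoGL]

theorem projRep_endoGL_iterate [DecidableEq ι] (φ : FreeGroup ι →* FreeGroup ι)
    (A : ι → GL (Fin 2) R) (n : ℕ) (w : FreeGroup ι) :
    projRep ((endoGL φ)^[n] A) w = projRep A (φ^[n] w) := by
  induction n generalizing w with
  | zero => rfl
  | succ n ih =>
    rw [Function.iterate_succ_apply', projRep_endoGL, MonoidHom.comp_apply, ih,
      Function.iterate_succ_apply]

theorem apply_zero_one_eq_zero_of_mk_eq {g h : GL (Fin 2) R} (e : (g : PGL₂ R) = h)
    (hg : g.val 0 1 = 0) : h.val 0 1 = 0 := by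
  rw [QuotientGroup.eq, GeneralLinearGroup.mem_center_iff_val_mem_range_scalar] at e
  obtain ⟨r, hr⟩ := e
  have h1 : h.val = g.val * scalar (Fin 2) r := by
    rw [hr, ← Units.val_mul, mul_inv_cancel_left]
  rw [h1]
  simp [hg]

theorem projRep_ne_one [DecidableEq ι] {A : ι → GL (Fin 2) R} {w : FreeGroup ι}
    (h : wordMatrix (fun i => (A i).val) w.toWord 0 1 ≠ 0) : projRep A w ≠ 1 := by
  intro h1
  rw [← coe_wordGL] at h
  refine h (apply_zero_one_eq_zero_of_mk_eq (g := 1) ?_ (by simp))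
  rw [mk_wordGL, FreeGroup.mk_toWord, h1]
  rfl

section Degenerate

variable {c : ι × Bool → R}

/-- Rank-one matrices `A i` such that `A i` and its adjugate have image spanned by
`(1, c (i, true))` and `(1, c (i, false))` respectively. -/
def rankOne (c : ι × Bool → R) (i : ι) : Matrix (Fin 2) (Fin 2) R :=
  !![c (i, false), -1; c (i, true) * c (i, false), -c (i, true)]

theorem wordMatrix_rankOne [IsDomain R] (hc : Function.Injective c) (x : ι × Bool)
    (L : List (ι × Bool)) (hL : FreeGroup.IsReduced (x :: L)) :
    wordMatrix (rankOne c) (x :: L) 0 1 ≠ 0 ∧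
      wordMatrix (rankOne c) (x :: L) 1 1 = wordMatrix (rankOne c) (x :: L) 0 1 * c x := by
  induction L generalizing x with
  | nil =>
    obtain ⟨i, _ | _⟩ := x <;>
      simp [wordMatrix, rankOne, adjugate_fin_two]
  | cons y L ih =>
    rw [FreeGroup.isReduced_cons_cons] at hL
    obtain ⟨h1, h2⟩ := ih y hL.2
    rw [wordMatrix_cons]
    set W := wordMatrix (rankOne c) (y :: L)
    have hne : ∀ i b, x = (i, b) → c (i, !b) - c y ≠ 0 := by
      rintro i b rfl h
      have := hc (sub_eq_zero.1 h)
      subst this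
      simp at hL
    obtain ⟨i, _ | _⟩ := x
    · have e : c y - c (i, true) ≠ 0 := by
        rw [← neg_sub, neg_ne_zero]; exact hne i false rfl
      simp only [rankOne, adjugate_fin_two, cond_false, Matrix.mul_apply, Fin.sum_univ_two, h2]
      simp
      refine ⟨?_, by ring⟩
      convert mul_ne_zero h1 e using 1
      ring_nf
    · have e : c (i, false) - c y ≠ 0 := hne i true rfl
      simp only [rankOne, cond_true, Matrix.mul_apply, Fin.sum_univ_two, h2]
      simp
      refine ⟨?_, by ring⟩
      convert mul_ne_zero h1 e using 1
      ring_nf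

end Degenerate

/-- The tuple of matrices with given entries. -/
def matrixTuple (a : ι × Fin 2 × Fin 2 → R) (i : ι) : Matrix (Fin 2) (Fin 2) R :=
  Matrix.of fun r s => a (i, r, s)

section Generic

open MvPolynomial

variable (F : Type*) [Field F]

/-- The tuple of generic matrices. -/
noncomputable abbrev genericMatrix (i : ι) :
    Matrix (Fin 2) (Fin 2) (MvPolynomial (ι × Fin 2 × Fin 2) F) :=
  matrixTuple X i

variable {F}

theorem aeval_genericMatrix [Algebra F R] (a : ι × Fin 2 × Fin 2 → R) (i : ι) :
    (aeval a).toRingHom.mapMatrix (genericMatrix F i) = matrixTuple a i := by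
  ext r s
  simp [matrixTuple]

theorem aeval_wordMatrix_generic [Algebra F R] (a : ι × Fin 2 × Fin 2 → R)
    (L : List (ι × Bool)) (r s : Fin 2) :
    aeval a (wordMatrix (genericMatrix F) L r s) = wordMatrix (matrixTuple a) L r s := by
  have h := wordMatrix_map (aeval a : _ →ₐ[F] R).toRingHom (genericMatrix F) L
  simp_rw [aeval_genericMatrix] at h
  rw [show matrixTuple a = fun i => matrixTuple a i from rfl, h]
  rfl

theorem aeval_det_generic [Algebra F R] (a : ι × Fin 2 × Fin 2 → R) (i : ι) :
    aeval a (genericMatrix F i).det = (matrixTuple a i).det := by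
  rw [← aeval_genericMatrix (F := F), ← RingHom.map_det]
  rfl

theorem det_genericMatrix_ne_zero (i : ι) : (genericMatrix F i).det ≠ 0 := by
  intro h
  have := aeval_det_generic (F := F) (fun s : ι × Fin 2 × Fin 2 => if s.2.1 = s.2.2 then (1 : F)
    else 0) i
  rw [h, map_zero] at this
  simp [matrixTuple, Matrix.det_fin_two] at this

theorem wordMatrix_generic_ne_zero [DecidableEq ι] {w : FreeGroup ι} (hw : w ≠ 1) :
    wordMatrix (genericMatrix F) w.toWord 0 1 ≠ 0 := by
  intro h
  obtain ⟨x, L, hL⟩ := List.exists_cons_of_ne_nil (mt FreeGroup.toWord_eq_nil_iff.1 hw)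
  set c : ι × Bool → MvPolynomial (ι × Bool) F := X with hc
  have h1 := wordMatrix_rankOne (X_injective : Function.Injective c) x L
    (hL ▸ FreeGroup.isReduced_toWord)
  have h2 := aeval_wordMatrix_generic (F := F) (fun s => rankOne c s.1 s.2.1 s.2.2) w.toWord 0 1
  rw [h, map_zero, hL] at h2
  exact h1.1 h2.symm

/-- The polynomial self-map of tuples of matrices induced by an endomorphism of the free
group. -/
noncomputable def endoPoly [DecidableEq ι] (F : Type*) [Field F] (φ : FreeGroup ι →* FreeGroup ι)
    (s : ι × Fin 2 × Fin 2) : MvPolynomial (ι × Fin 2 × Fin 2) F :=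
  wordMatrix (genericMatrix F) (φ (FreeGroup.of s.1)).toWord s.2.1 s.2.2

/-- The entries of a tuple in `GL₂`. -/
def entries (A : ι → GL (Fin 2) R) (s : ι × Fin 2 × Fin 2) : R :=
  (A s.1).val s.2.1 s.2.2

theorem aeval_entries_endoPoly [DecidableEq ι] [Algebra F R] (φ : FreeGroup ι →* FreeGroup ι)
    (A : ι → GL (Fin 2) R) (s : ι × Fin 2 × Fin 2) :
    aeval (entries A) (endoPoly F φ s) = entries (endoGL φ A) s := by
  rw [endoPoly, aeval_wordMatrix_generic, entries, endoGL, coe_wordGL]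
  rfl

theorem aeval_entries_bind₁_iterate [DecidableEq ι] [Algebra F R]
    (φ : FreeGroup ι →* FreeGroup ι) (A : ι → GL (Fin 2) R) (n : ℕ)
    (g : MvPolynomial (ι × Fin 2 × Fin 2) F) :
    aeval (entries A) ((bind₁ (endoPoly F φ))^[n] g) = aeval (entries ((endoGL φ)^[n] A)) g := by
  induction n generalizing A with
  | zero => rfl
  | succ n ih =>
    rw [Function.iterate_succ_apply', Function.iterate_succ_apply, aeval_bind₁]
    simp_rw [aeval_entries_endoPoly]
    exact ih _

variable [Fintype ι]

/-- The polynomial whose nonvanishing at a tuple says that the matrices are invertible and that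
the word `w` has nonzero upper right entry. -/
noncomputable def detector [DecidableEq ι] (F : Type*) [Field F] (w : FreeGroup ι) :
    MvPolynomial (ι × Fin 2 × Fin 2) F :=
  (∏ i, (genericMatrix F i).det) * wordMatrix (genericMatrix F) w.toWord 0 1

theorem aeval_detector [DecidableEq ι] [Algebra F R] (a : ι × Fin 2 × Fin 2 → R)
    (w : FreeGroup ι) :
    aeval a (detector F w) =
      (∏ i, (matrixTuple a i).det) * wordMatrix (matrixTuple a) w.toWord 0 1 := by
  rw [detector, map_mul, map_prod, aeval_wordMatrix_generic]
  simp_rw [aeval_det_generic]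

theorem bind₁_iterate_detector_ne_zero [DecidableEq ι] {φ : FreeGroup ι →* FreeGroup ι}
    (hφ : Function.Injective φ) {w : FreeGroup ι} (hw : w ≠ 1) (n : ℕ) :
    (bind₁ (endoPoly F φ))^[n] (detector F w) ≠ 0 := by
  intro h0
  set P := MvPolynomial (ι × Fin 2 × Fin 2) F
  set E := FractionRing P
  have hinj : Function.Injective (algebraMap P E) := IsFractionRing.injective P E
  have hdet : ∀ i, ((algebraMap P E).mapMatrix (genericMatrix F i)).det ≠ 0 := fun i => by
    rw [← RingHom.map_det]
    exact (map_ne_zero_iff _ hinj).2 (det_genericMatrix_ne_zero i)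
  set A : ι → GL (Fin 2) E := fun i => GeneralLinearGroup.mkOfDetNeZero _ (hdet i) with hA
  have h1 := aeval_entries_bind₁_iterate (F := F) φ A n (detector F w)
  set B := (endoGL φ)^[n] A with hB
  rw [h0, map_zero, aeval_detector, eq_comm, mul_eq_zero, Finset.prod_eq_zero_iff] at h1
  obtain ⟨i, -, hi⟩ | h1 := h1
  · exact (GeneralLinearGroup.det (B i)).ne_zero hi
  · have h2 : (wordGL B w.toWord).val 0 1 = 0 := by
      rw [coe_wordGL]; exact h1
    have h3 : (wordGL B w.toWord : PGL₂ E) = wordGL A (φ^[n] w).toWord := by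
      rw [mk_wordGL, mk_wordGL, FreeGroup.mk_toWord, FreeGroup.mk_toWord, hB,
        projRep_endoGL_iterate]
    have h4 := apply_zero_one_eq_zero_of_mk_eq h3 h2
    rw [coe_wordGL] at h4
    have h5 : wordMatrix (fun i => (A i).val) (φ^[n] w).toWord =
        (algebraMap P E).mapMatrix (wordMatrix (genericMatrix F) (φ^[n] w).toWord) :=
      wordMatrix_map _ _ _
    rw [h5, RingHom.mapMatrix_apply, Matrix.map_apply, map_eq_zero_iff _ hinj] at h4
    refine wordMatrix_generic_ne_zero (fun h => hw ?_) h4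
    exact hφ.iterate n (h.trans (Function.iterate_fixed (map_one φ) n).symm)

end Generic

theorem endoGL_map [DecidableEq ι] (σ : R →+* S) (φ : FreeGroup ι →* FreeGroup ι)
    (A : ι → GL (Fin 2) R) :
    endoGL φ (fun i => GeneralLinearGroup.map σ (A i)) =
      fun i => GeneralLinearGroup.map σ (endoGL φ A i) := by
  ext1 i
  apply Units.ext
  rw [endoGL, coe_wordGL]
  refine (wordMatrix_map σ (fun i => (A i).val) _).trans ?_
  rw [← coe_wordGL]
  rfl

theorem GL_map_injective {σ : R →+* S} (hσ : Function.Injective σ) :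
    Function.Injective (GeneralLinearGroup.map (n := Fin 2) σ) := fun g h e => by
  ext r s
  exact hσ (congrArg (fun x : GL (Fin 2) S => x.val r s) e)

/-- For an injective endomorphism `φ` of a free group of finite rank, nontrivial elements are
detected by homomorphisms to finite groups that are periodic under precomposition with `φ`. -/
theorem FreeGroup.exists_periodic_hom [Finite ι] {φ : FreeGroup ι →* FreeGroup ι}
    (hφ : Function.Injective φ) {w : FreeGroup ι} (hw : w ≠ 1) :
    ∃ (H : Type) (_ : Group H) (_ : Finite H) (ρ : FreeGroup ι →* H),
      ρ ∈ Function.periodicPts (fun ρ : FreeGroup ι →* H => ρ.comp φ) ∧ ρ w ≠ 1 := by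
  classical
  have := Fintype.ofFinite ι
  obtain ⟨a, m, ha, hD⟩ := MvPolynomial.exists_quasiFixed (p := 2)
    (bind₁_iterate_detector_ne_zero (F := ZMod 2) hφ hw _)
  set L := IntermediateField.adjoin (ZMod 2) (Set.range a) with hL
  have : FiniteDimensional (ZMod 2) L := IntermediateField.finiteDimensional_adjoin
    fun x _ => Algebra.IsIntegral.isIntegral x
  have : Finite L := Module.finite_of_finite (ZMod 2)
  have : CharP L 2 := charP_of_injective_algebraMap (algebraMap (ZMod 2) L).injective 2
  set b : ι × Fin 2 × Fin 2 → L :=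
    fun s => ⟨a s, IntermediateField.subset_adjoin _ _ ⟨s, rfl⟩⟩ with hb
  have hab : ∀ g : MvPolynomial _ (ZMod 2),
      ((MvPolynomial.aeval b g : L) : AlgebraicClosure (ZMod 2)) =
        MvPolynomial.aeval a g := fun g =>
    MvPolynomial.comp_aeval_apply b L.val g
  have hb1 : ∀ s, MvPolynomial.aeval b (endoPoly (ZMod 2) φ s) = b s ^ 2 ^ m := fun s => by
    apply Subtype.ext
    rw [hab, ha]
    rfl
  have hb2 : MvPolynomial.aeval b (detector (ZMod 2) w) ≠ 0 := fun h => hD <| by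
    rw [← hab, h]
    rfl
  rw [aeval_detector] at hb2
  have hdet : ∀ i, (matrixTuple b i).det ≠ 0 := fun i =>
    Finset.prod_ne_zero_iff.1 (left_ne_zero_of_mul hb2) i (Finset.mem_univ i)
  set A : ι → GL (Fin 2) L := fun i => GeneralLinearGroup.mkOfDetNeZero _ (hdet i) with hA
  set Fr : (ι → GL (Fin 2) L) → (ι → GL (Fin 2) L) :=
    fun B i => GeneralLinearGroup.map (iterateFrobenius L 2 m) (B i) with hFr
  have hFrA : endoGL φ A = Fr A := by
    funext i
    refine Units.ext (Matrix.ext fun r s => ?_)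
    have h1 := aeval_entries_endoPoly (F := ZMod 2) φ A (i, r, s)
    exact h1.symm.trans (hb1 (i, r, s))
  have hcomm : Function.Commute Fr (endoGL φ) := fun B => (endoGL_map _ φ B).symm
  have hiter : ∀ n, (endoGL φ)^[n] A = Fr^[n] A := by
    intro n
    induction n with
    | zero => rfl
    | succ n ih =>
      rw [Function.iterate_succ_apply', ih, ← (hcomm.iterate_left n).eq, hFrA,
        Function.iterate_succ_apply]
  have hinj : Function.Injective Fr := fun B C h => by
    ext1 i
    exact GL_map_injective (iterateFrobenius L 2 m).injective (congrFun h i)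
  obtain ⟨n, hn, hper⟩ := hinj.mem_periodicPts A
  have hAper : A ∈ Function.periodicPts (endoGL φ : (ι → GL (Fin 2) L) → _) :=
    ⟨n, hn, (hiter n).trans hper⟩
  have hsemi : Function.Semiconj projRep (endoGL φ : (ι → GL (Fin 2) L) → _)
      (fun ρ : FreeGroup ι →* PGL₂ L => ρ.comp φ) := projRep_endoGL φ
  exact ⟨PGL₂ L, inferInstance, inferInstance, projRep A, hsemi.mapsTo_periodicPts hAper,
    projRep_ne_one (right_ne_zero_of_mul hb2)⟩

end WordMaps

section Detection

open Function

theorem exists_finiteIndex_of_map_ne_one {G H : Type*} [Group G] [Group H] [Finite H]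
    (f : G →* H) {g : G} (hg : f g ≠ 1) :
    ∃ N : Subgroup G, N.Normal ∧ N.FiniteIndex ∧ g ∉ N :=
  ⟨f.ker, inferInstance, inferInstance, hg⟩

theorem ResiduallyFinite.of_mulEquiv {G H : Type*} [Group G] [Group H] (e : G ≃* H)
    (h : ResiduallyFinite G) : ResiduallyFinite H := by
  intro x hx
  obtain ⟨N, hN, hfin, hxN⟩ := h (e.symm x) (by simpa using hx)
  have : Finite (G ⧸ N) := N.finite_quotient_of_finiteIndex
  refine exists_finiteIndex_of_map_ne_one ((QuotientGroup.mk' N).comp e.symm.toMonoidHom) ?_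
  simpa using hxN

namespace AscendingHNNExtension

variable {G H : Type*} [Group G] [Group H] {φ : G →* G} {hφ : Injective φ}

theorem inv_t_mul_of (g : G) :
    (HNNExtension.t⁻¹ * HNNExtension.of g : AscendingHNNExtension φ hφ) =
      HNNExtension.of (φ g) * HNNExtension.t⁻¹ :=
  HNNExtension.inv_t_mul_of (⟨g, trivial⟩ : (⊤ : Subgroup G))

theorem of_mul_t (g : G) :
    (HNNExtension.of g * HNNExtension.t : AscendingHNNExtension φ hφ) =
      HNNExtension.t * HNNExtension.of (φ g) :=
  HNNExtension.of_mul_t (⟨g, trivial⟩ : (⊤ : Subgroup G))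

/-- The homomorphism out of an ascending HNN extension given by a homomorphism on the base group
and the image of the stable letter. -/
noncomputable def lift (f : G →* H) (x : H) (hx : ∀ g, x * f (φ g) = f g * x) :
    AscendingHNNExtension φ hφ →* H :=
  HNNExtension.lift f x <| by
    rintro ⟨_, g, rfl⟩
    have e : (MonoidHom.ofInjective hφ).symm ⟨φ g, g, rfl⟩ = g :=
      (MonoidHom.ofInjective hφ).symm_apply_apply g
    simpa [e] using hx g

@[simp]
theorem lift_of (f : G →* H) (x : H) (hx : ∀ g, x * f (φ g) = f g * x) (g : G) :
    lift (hφ := hφ) f x hx (HNNExtension.of g) = f g :=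
  HNNExtension.lift_of _ _ _ _

@[simp]
theorem lift_t (f : G →* H) (x : H) (hx : ∀ g, x * f (φ g) = f g * x) :
    lift (hφ := hφ) f x hx HNNExtension.t = x :=
  HNNExtension.lift_t _ _ _

theorem of_mul_t_pow (g : G) (n : ℕ) :
    (HNNExtension.of g * HNNExtension.t ^ n : AscendingHNNExtension φ hφ) =
      HNNExtension.t ^ n * HNNExtension.of (φ^[n] g) := by
  induction n generalizing g with
  | zero => simp
  | succ n ih =>
    rw [pow_succ', ← mul_assoc, of_mul_t, mul_assoc, ih, ← mul_assoc, iterate_succ_apply]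

theorem inv_t_pow_mul_of (g : G) (n : ℕ) :
    ((HNNExtension.t ^ n)⁻¹ * HNNExtension.of g : AscendingHNNExtension φ hφ) =
      HNNExtension.of (φ^[n] g) * (HNNExtension.t ^ n)⁻¹ := by
  rw [inv_mul_eq_iff_eq_mul, ← mul_assoc, ← of_mul_t_pow, mul_inv_cancel_right]

theorem exists_eq_t_pow_mul_of_mul (x : AscendingHNNExtension φ hφ) :
    ∃ (a b : ℕ) (g : G), x = HNNExtension.t ^ a * HNNExtension.of g * (HNNExtension.t ^ b)⁻¹ := by
  induction x using HNNExtension.induction_on with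
  | of g => exact ⟨0, 0, g, by simp⟩
  | t => exact ⟨1, 0, 1, by simp⟩
  | inv x ih =>
    obtain ⟨a, b, g, rfl⟩ := ih
    exact ⟨b, a, g⁻¹, by simp [mul_assoc]⟩
  | mul x y hx hy =>
    obtain ⟨a, b, g, rfl⟩ := hx
    obtain ⟨c, d, h, rfl⟩ := hy
    rcases le_total b c with hbc | hbc
    · obtain ⟨e, rfl⟩ := Nat.exists_eq_add_of_le hbc
      refine ⟨a + e, d, φ^[e] g * h, ?_⟩
      trans HNNExtension.t ^ a * (HNNExtension.of g * HNNExtension.t ^ e) *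
        HNNExtension.of h * (HNNExtension.t ^ d)⁻¹
      · simp only [pow_add, mul_assoc, inv_mul_cancel_left]
      · simp only [of_mul_t_pow, map_mul, pow_add, mul_assoc]
    · obtain ⟨e, rfl⟩ := Nat.exists_eq_add_of_le hbc
      refine ⟨a, d + e, g * φ^[e] h, ?_⟩
      trans HNNExtension.t ^ a * HNNExtension.of g *
        ((HNNExtension.t ^ e)⁻¹ * HNNExtension.of h) * (HNNExtension.t ^ d)⁻¹
      · simp only [pow_add, mul_inv_rev, mul_assoc, inv_mul_cancel_left]
      · simp only [inv_t_pow_mul_of, map_mul, pow_add, mul_inv_rev, mul_assoc]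

/-- The exponent of the stable letter. -/
noncomputable def level (φ : G →* G) (hφ : Injective φ) :
    AscendingHNNExtension φ hφ →* Multiplicative ℤ :=
  lift 1 (Multiplicative.ofAdd 1) fun _ => by simp

theorem level_of (g : G) : level φ hφ (HNNExtension.of g) = 1 := by simp [level]

theorem level_t : level φ hφ HNNExtension.t = Multiplicative.ofAdd 1 := by simp [level]

theorem level_t_pow_mul_of_mul (a b : ℕ) (g : G) :
    level φ hφ (HNNExtension.t ^ a * HNNExtension.of g * (HNNExtension.t ^ b)⁻¹) =
      Multiplicative.ofAdd ((a : ℤ) - b) := by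
  simp only [map_mul, map_pow, map_inv, level_of, level_t, ← ofAdd_nsmul, ← ofAdd_neg,
    mul_one, ← ofAdd_add]
  simp [sub_eq_add_neg]

theorem residuallyFinite_of_base
    (h : ∀ g : G, g ≠ 1 → ∃ N : Subgroup (AscendingHNNExtension φ hφ),
      N.Normal ∧ N.FiniteIndex ∧ HNNExtension.of g ∉ N) :
    ResiduallyFinite (AscendingHNNExtension φ hφ) := by
  intro x hx
  obtain ⟨a, b, g, rfl⟩ := exists_eq_t_pow_mul_of_mul x
  by_cases hab : a = b
  · subst hab
    obtain ⟨N, hN, hfin, hgN⟩ := h g (by rintro rfl; simp at hx)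
    exact ⟨N, hN, hfin, fun hmem => hgN (by
      simpa [mul_assoc] using hN.conj_mem _ hmem (HNNExtension.t ^ a)⁻¹)⟩
  · refine exists_finiteIndex_of_map_ne_one (H := Multiplicative (ZMod (a + b + 1)))
      ((Int.castAddHom (ZMod (a + b + 1))).toMultiplicative.comp (level φ hφ)) ?_
    rw [MonoidHom.comp_apply, level_t_pow_mul_of_mul]
    intro h1
    have h2 : (((a : ℤ) - b : ℤ) : ZMod (a + b + 1)) = 0 := h1
    rw [ZMod.intCast_zmod_eq_zero_iff_dvd] at h2
    have h3 := Int.eq_zero_of_abs_lt_dvd h2 (by rw [abs_lt]; constructor <;> push_cast <;> omega)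
    omega

/-- Homomorphisms to a finite group that are periodic under precomposition with `φ` extend to
finite permutation representations of the ascending HNN extension. -/
theorem exists_finiteIndex_of_periodic [Finite H] [Finite (G →* H)] {ρ : G →* H}
    (hρ : ρ ∈ periodicPts fun ρ : G →* H => ρ.comp φ) {g : G} (hg : ρ g ≠ 1) :
    ∃ N : Subgroup (AscendingHNNExtension φ hφ),
      N.Normal ∧ N.FiniteIndex ∧ HNNExtension.of g ∉ N := by
  set S := periodicPts fun ρ : G →* H => ρ.comp φ with hS
  let τ : Equiv.Perm S := (bijOn_periodicPts fun ρ : G →* H => ρ.comp φ).equiv _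
  let T : Equiv.Perm (S × H) := τ.prodCongr (Equiv.refl H)
  let f : G →* Equiv.Perm (S × H) := MonoidHom.toHomPerm
    { toFun := fun k x => (x.1, x.1.1 k * x.2)
      map_one' := by
        funext x
        simp [Function.End.one_def]
      map_mul' := fun k l => funext fun x => Prod.ext rfl <|
        (congrArg (· * x.2) (map_mul x.1.1 k l)).trans (mul_assoc _ _ _) }
  have hf : ∀ k x, f k x = (x.1, x.1.1 k * x.2) := fun _ _ => rfl
  let Θ : AscendingHNNExtension φ hφ →* Equiv.Perm (S × H) := lift f T fun k =>
    Equiv.ext fun _ => rfl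
  refine exists_finiteIndex_of_map_ne_one Θ fun h1 => hg ?_
  rw [lift_of] at h1
  have h2 := congrArg Prod.snd (Equiv.congr_fun h1 (⟨ρ, hρ⟩, 1))
  simpa [hf] using h2

end AscendingHNNExtension

theorem exists_iterate_mem_periodicPts {α : Type*} [Finite α] (f : α → α) (x : α) :
    ∃ n, f^[n] x ∈ periodicPts f := by
  obtain ⟨m, n, hne, e⟩ := Finite.exists_ne_map_eq_of_infinite fun n : ℕ => f^[n] x
  wlog hmn : m < n generalizing m n
  · exact this n m hne.symm e.symm (hne.lt_or_gt.resolve_left hmn)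
  refine ⟨m, n - m, Nat.sub_pos_of_lt hmn, ?_⟩
  rw [IsPeriodicPt, IsFixedPt, ← iterate_add_apply, Nat.sub_add_cancel hmn.le]
  exact e.symm

theorem FreeGroup.exists_section {ι K : Type*} [Group K] {π : K →* FreeGroup ι}
    (hπ : Surjective π) : ∃ s : FreeGroup ι →* K, ∀ w, π (s w) = w := by
  refine ⟨FreeGroup.lift fun i => (hπ (FreeGroup.of i)).choose, fun w => ?_⟩
  refine DFunLike.congr_fun (f := π.comp _) (g := MonoidHom.id _)
    (FreeGroup.ext_hom _ _ fun i => ?_) w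
  simpa using (hπ (FreeGroup.of i)).choose_spec

theorem finite_monoidHom_of_finite_ker {ι K H : Type*} [Finite ι] [Group K] [Group H] [Finite H]
    {π : K →* FreeGroup ι} (hπ : Surjective π) [Finite π.ker] : Finite (K →* H) := by
  obtain ⟨s, hs⟩ := FreeGroup.exists_section hπ
  refine Finite.of_injective (β := (π.ker → H) × (ι → H))
    (fun ρ => (fun k => ρ k, fun i => ρ (s (FreeGroup.of i)))) fun ρ σ h => ?_
  obtain ⟨h1, h2⟩ := Prod.ext_iff.1 h
  have h3 : ρ.comp s = σ.comp s := FreeGroup.ext_hom _ _ fun i => congrFun h2 i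
  ext k
  have h4 := congrFun h1 ⟨k * (s (π k))⁻¹, by simp [MonoidHom.mem_ker, hs]⟩
  have h5 := DFunLike.congr_fun h3 (π k)
  simp only [MonoidHom.comp_apply, map_mul, map_inv] at h4 h5
  rw [h5] at h4
  exact mul_right_cancel h4

theorem exists_monoidHom_perm_ker_injOn {ι K : Type*} [Group K] {π : K →* FreeGroup ι}
    (hπ : Surjective π) :
    ∃ ρ : K →* Equiv.Perm π.ker, ∀ k ∈ π.ker, ρ k = 1 → k = 1 := by
  obtain ⟨s, hs⟩ := FreeGroup.exists_section hπ
  refine ⟨MonoidHom.toHomPerm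
    { toFun := fun k x => ⟨k * x * (s (π k))⁻¹, by
        have := MonoidHom.mem_ker.1 x.2
        simp [MonoidHom.mem_ker, hs, this]⟩
      map_one' := by
        funext x
        simp [Function.End.one_def]
      map_mul' := fun k l => funext fun x => Subtype.ext ?_ }, fun k hk h1 => ?_⟩
  · trans k * (l * x * (s (π l))⁻¹) * (s (π k))⁻¹
    · simp [mul_assoc]
    · rfl
  · have h2 : k * (1 : K) * (s (π k))⁻¹ = 1 := congrArg Subtype.val (Equiv.congr_fun h1 1)
    simpa [MonoidHom.mem_ker.1 hk] using h2

theorem AscendingHNNExtension.residuallyFinite_of_finite_ker {ι K : Type*} [Finite ι] [Group K]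
    {π : K →* FreeGroup ι} (hπ : Surjective π) [Finite π.ker]
    {φ : FreeGroup ι →* FreeGroup ι} (hφ : Injective φ) {ψ : K →* K} (hψ : Injective ψ)
    (h : ∀ k, π (ψ k) = φ (π k)) : ResiduallyFinite (AscendingHNNExtension ψ hψ) := by
  refine residuallyFinite_of_base fun k hk => ?_
  by_cases hπk : π k = 1
  · obtain ⟨ρ, hρ⟩ := exists_monoidHom_perm_ker_injOn hπ
    have : Finite (K →* Equiv.Perm π.ker) := finite_monoidHom_of_finite_ker hπ
    obtain ⟨n, hn⟩ := exists_iterate_mem_periodicPts (fun ρ : K →* Equiv.Perm π.ker => ρ.comp ψ) ρ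
    refine exists_finiteIndex_of_periodic hn ?_ (g := k)
    have key : ∀ n (k : K), ((fun ρ : K →* Equiv.Perm π.ker => ρ.comp ψ)^[n] ρ) k =
        ρ (ψ^[n] k) := by
      intro n
      induction n with
      | zero => exact fun _ => rfl
      | succ n ih =>
        intro k
        rw [iterate_succ_apply', MonoidHom.comp_apply, ih, iterate_succ_apply]
    have hker : ∀ n, ψ^[n] k ∈ π.ker := fun n => by
      induction n with
      | zero => exact hπk
      | succ n ih => rw [iterate_succ_apply', MonoidHom.mem_ker, h, MonoidHom.mem_ker.1 ih, map_one]
    rw [key]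
    exact fun h1 => hk <| hψ.iterate n <|
      (hρ _ (hker n) h1).trans (iterate_fixed (map_one ψ) n).symm
  · obtain ⟨H, _, _, ρ, hρ, hρk⟩ := FreeGroup.exists_periodic_hom hφ hπk
    have : Finite (K →* H) := finite_monoidHom_of_finite_ker hπ
    have hsemi : Semiconj (fun ρ : FreeGroup ι →* H => ρ.comp π)
        (fun ρ : FreeGroup ι →* H => ρ.comp φ) (fun ρ : K →* H => ρ.comp ψ) := fun ρ => by
      ext k
      simp [h]
    exact exists_finiteIndex_of_periodic (hsemi.mapsTo_periodicPts hρ) hρk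

theorem AscendingHNNExtension.exists_mulEquiv_of_surjective {G E : Type*} [Group G] [Group E]
    {φ : G →* G} {hφ : Injective φ} {π : E →* AscendingHNNExtension φ hφ} (hπ : Surjective π) :
    ∃ (K : Subgroup E) (πK : K →* G) (ψ : K →* K) (hψ : Injective ψ),
      (∀ k, HNNExtension.of (πK k) = π k) ∧ Surjective πK ∧ (∀ k, πK (ψ k) = φ (πK k)) ∧
        Nonempty (AscendingHNNExtension ψ hψ ≃* E) := by
  obtain ⟨t, ht⟩ := hπ HNNExtension.t
  have hof : Injective (HNNExtension.of : G →* AscendingHNNExtension φ hφ) :=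
    HNNExtension.of_injective _
  let K : Subgroup E := (HNNExtension.of : G →* AscendingHNNExtension φ hφ).range.comap π
  let πK : K →* G := (MonoidHom.ofInjective hof).symm.toMonoidHom.comp
    (π.subgroupComap (HNNExtension.of : G →* AscendingHNNExtension φ hφ).range)
  have hπK : ∀ k, HNNExtension.of (πK k) = π k := fun k =>
    MonoidHom.apply_ofInjective_symm hof _
  have hmem : ∀ k : K, t⁻¹ * k * t ∈ K := fun k => ⟨φ (πK k), by
    rw [map_mul, map_mul, map_inv, ht, ← hπK, inv_t_mul_of, inv_mul_cancel_right]⟩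
  let ψ : K →* K :=
    { toFun := fun k => ⟨t⁻¹ * k * t, hmem k⟩
      map_one' := by simp
      map_mul' := fun k l => Subtype.ext <| by simp [mul_assoc] }
  have hψ : Injective ψ := fun k l h => by
    have := congrArg Subtype.val h
    simpa [ψ] using this
  have hπψ : ∀ k, πK (ψ k) = φ (πK k) := fun k => hof <| by
    rw [hπK]
    change π (t⁻¹ * k * t) = _
    rw [map_mul, map_mul, map_inv, ht, ← hπK, inv_t_mul_of, inv_mul_cancel_right]
  let p : AscendingHNNExtension ψ hψ →* E := lift K.subtype t fun k => by
    simp [ψ, mul_assoc]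
  have hpt : p HNNExtension.t = t := lift_t _ _ _
  have hpof : ∀ k : K, p (HNNExtension.of k) = k := fun k => lift_of _ _ _ k
  have hp : ∀ (a b : ℕ) (k : K), p (HNNExtension.t ^ a * HNNExtension.of k *
      (HNNExtension.t ^ b)⁻¹) = t ^ a * k * (t ^ b)⁻¹ := fun a b k => by
    simp [hpt, hpof]
  refine ⟨K, πK, ψ, hψ, hπK, fun g => ?_, hπψ, ⟨MulEquiv.ofBijective p ⟨?_, fun e => ?_⟩⟩⟩
  · obtain ⟨e, he⟩ := hπ (HNNExtension.of g)
    exact ⟨⟨e, g, he.symm⟩, hof ((hπK _).trans he)⟩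
  · rw [injective_iff_map_eq_one]
    intro x hx
    obtain ⟨a, b, k, rfl⟩ := exists_eq_t_pow_mul_of_mul x
    rw [hp] at hx
    have h1 := congrArg (fun e => level φ hφ (π e)) hx
    simp only [map_mul π, map_inv, map_pow, ht, ← hπK] at h1
    rw [level_t_pow_mul_of_mul, map_one, map_one, ofAdd_eq_one, sub_eq_zero, Nat.cast_inj] at h1
    subst h1
    have h2 : k = 1 := Subtype.ext (conj_eq_one_iff.1 hx)
    simp [h2]
  · obtain ⟨a, b, g, hg⟩ := exists_eq_t_pow_mul_of_mul (π e)
    have hk : (t ^ a)⁻¹ * e * t ^ b ∈ K := ⟨g, by simp [ht, hg, mul_assoc]⟩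
    exact ⟨_, (hp a b ⟨_, hk⟩).trans (by simp [mul_assoc])⟩

end Detection

/-- If `G` is a free group of finite rank and `φ : G → G` is a monomorphism, then the
ascending HNN extension `G_φ` is highly residually finite. -/
theorem statement14 {G : Type*} [Group G]
    (hfree : ∃ n : ℕ, Nonempty (G ≃* FreeGroup (Fin n)))
    (φ : G →* G) (hφ : Function.Injective φ) :
    HighlyResiduallyFinite (AscendingHNNExtension φ hφ) := by
  intro E F _ _ _ i π hi hπ hker
  obtain ⟨n, ⟨e⟩⟩ := hfree
  obtain ⟨K, πK, ψ, hψ, hof, hsurj, hcomm, ⟨f⟩⟩ :=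
    AscendingHNNExtension.exists_mulEquiv_of_surjective hπ
  have : Finite π.ker := by
    rw [hker]
    exact Set.finite_range i
  have : Finite (e.toMonoidHom.comp πK).ker := by
    refine Finite.of_injective (β := π.ker) (fun k => ⟨k.1.1, ?_⟩) fun k l h => ?_
    · have h1 : e (πK k.1) = 1 := k.2
      rw [MonoidHom.mem_ker, ← hof, (map_eq_one_iff e e.injective).1 h1, map_one]
    · exact Subtype.ext (Subtype.ext (congrArg (fun x : π.ker => x.1) h))
  refine ResiduallyFinite.of_mulEquiv f
    (AscendingHNNExtension.residuallyFinite_of_finite_ker (π := e.toMonoidHom.comp πK)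
      (e.surjective.comp hsurj) (φ := (e.toMonoidHom.comp φ).comp e.symm.toMonoidHom)
      (e.injective.comp (hφ.comp e.symm.injective)) hψ fun k => ?_)
  simp [hcomm]
end

section
/- If G is a polycyclic group, then every endomorphism φ : G → G has property 𝔓. -/
/-- An endomorphism `φ` of `G` has property 𝔓 if for every `g ∈ G` there is a
finite-index normal subgroup `N` such that for all `i ≥ 0`, `φ^i(g) ∈ N ↔ φ^i(g) = 1`. -/
def PropertyP {G : Type*} [Group G] (φ : G →* G) : Prop :=
  ∀ g : G, ∃ N : Subgroup G, N.Normal ∧ N.FiniteIndex ∧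
    ∀ i : ℕ, ((⇑φ)^[i] g ∈ N ↔ (⇑φ)^[i] g = 1)

/-- A group is polycyclic if it has a subnormal series with cyclic factors. -/
def IsPolycyclic (G : Type*) [Group G] : Prop :=
  ∃ (m : ℕ) (H : Fin (m + 1) → Subgroup G),
    H 0 = ⊥ ∧ H (Fin.last m) = ⊤ ∧
    ∀ i : Fin m, H i.castSucc ≤ H i.succ ∧
      ∃ hn : ((H i.castSucc).subgroupOf (H i.succ)).Normal,
        haveI := hn
        IsCyclic ((H i.succ) ⧸ (H i.castSucc).subgroupOf (H i.succ))

/-- The class of groups obtained from trivial groups by finitely many extensions with cyclic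
quotient. -/
inductive IsIteratedCyclicExtension.{u} : (G : Type u) → [Group G] → Prop
  | of_subsingleton (G : Type u) [Group G] [Subsingleton G] : IsIteratedCyclicExtension G
  | of_extension (G : Type u) [Group G] (N : Subgroup G) [N.Normal] [IsCyclic (G ⧸ N)]
      (hN : IsIteratedCyclicExtension N) : IsIteratedCyclicExtension G

namespace IsIteratedCyclicExtension

universe u

variable {G : Type u} [Group G]

theorem of_injective (hG : IsIteratedCyclicExtension G) :
    ∀ {H : Type u} [Group H] (f : H →* G), Function.Injective f →
      IsIteratedCyclicExtension H := by
  induction hG with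
  | of_subsingleton G =>
    intro H _ f hf
    have := hf.subsingleton
    exact of_subsingleton H
  | of_extension G N hN ih =>
    intro H _ f hf
    have : IsCyclic (H ⧸ N.comap f) := by
      refine isCyclic_of_injective (QuotientGroup.map (N.comap f) N f le_rfl) ?_
      rw [injective_iff_map_eq_one]
      intro x
      induction x using QuotientGroup.induction_on with
      | H x => simp [QuotientGroup.eq_one_iff]
    refine of_extension H (N.comap f) (ih (f.subgroupComap N) fun x y h => ?_)
    exact Subtype.ext (hf (congrArg Subtype.val h))

theorem of_surjective (hG : IsIteratedCyclicExtension G) :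
    ∀ {Q : Type u} [Group Q] (f : G →* Q), Function.Surjective f →
      IsIteratedCyclicExtension Q := by
  induction hG with
  | of_subsingleton G =>
    intro Q _ f hf
    have := hf.subsingleton
    exact of_subsingleton Q
  | of_extension G N hN ih =>
    intro Q _ f hf
    have hnormal : (N.map f).Normal := Subgroup.Normal.map inferInstance f hf
    have : IsCyclic (Q ⧸ N.map f) := by
      refine isCyclic_of_surjective
        (QuotientGroup.map N (N.map f) f (Subgroup.le_comap_map f N)) ?_
      exact QuotientGroup.map_surjective_of_surjective _ _ _
        ((QuotientGroup.mk'_surjective _).comp hf) _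
    exact of_extension Q (N.map f) (ih (f.subgroupMap N) (f.subgroupMap_surjective N))

theorem subgroup (hG : IsIteratedCyclicExtension G) (H : Subgroup G) :
    IsIteratedCyclicExtension H :=
  hG.of_injective H.subtype H.subtype_injective

theorem quotient (hG : IsIteratedCyclicExtension G) (N : Subgroup G) [N.Normal] :
    IsIteratedCyclicExtension (G ⧸ N) :=
  hG.of_surjective (QuotientGroup.mk' N) (QuotientGroup.mk'_surjective N)

theorem isSolvable (hG : IsIteratedCyclicExtension G) : Group.IsSolvable G := by
  induction hG with
  | of_subsingleton G => infer_instance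
  | of_extension G N hN ih =>
    have : Group.IsSolvable (G ⧸ N) := by
      let := IsCyclic.commGroup (α := G ⧸ N)
      infer_instance
    exact Group.isSolvable_of_ker_le_range N.subtype (QuotientGroup.mk' N) (by simp)

end IsIteratedCyclicExtension

/-- If `t` generates `G` modulo `N`, every element of `G` is an element of `N` times a power
of `t`. -/
theorem exists_mem_mul_zpow {G : Type*} [Group G] {N : Subgroup G} [N.Normal] {t : G}
    (ht : ∀ x : G ⧸ N, x ∈ Subgroup.zpowers (t : G ⧸ N)) (x : G) :
    ∃ e ∈ N, ∃ j : ℤ, x = e * t ^ j := by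
  obtain ⟨j, hj⟩ := Subgroup.mem_zpowers_iff.1 (ht x)
  refine ⟨x * t ^ (-j), ?_, j, by group⟩
  rw [← QuotientGroup.eq_one_iff, QuotientGroup.mk_mul, QuotientGroup.mk_zpow, ← hj]
  group

theorem Group.FG.of_cyclic_extension {G : Type*} [Group G] (N : Subgroup G) [N.Normal]
    [IsCyclic (G ⧸ N)] (hN : Group.FG N) : Group.FG G := by
  obtain ⟨t', ht⟩ := IsCyclic.exists_generator (α := G ⧸ N)
  obtain ⟨t, rfl⟩ := QuotientGroup.mk_surjective t'
  have hz : (Subgroup.zpowers t).FG := (Subgroup.fg_iff _).2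
    ⟨{t}, (Subgroup.zpowers_eq_closure t).symm, Set.finite_singleton t⟩
  have hfg := ((Group.fg_iff_subgroup_fg N).1 hN).sup hz
  have htop : N ⊔ Subgroup.zpowers t = ⊤ := by
    refine (Subgroup.eq_top_iff' _).2 fun x => ?_
    obtain ⟨e, he, j, rfl⟩ := exists_mem_mul_zpow ht x
    exact Subgroup.mul_mem_sup he (Subgroup.zpow_mem_zpowers t j)
  exact Group.fg_def.2 (htop ▸ hfg)

theorem finiteIndex_zpowers_pow {G : Type*} [Group G] {E : Subgroup G} [E.Normal] [Finite E]
    {t : G} (ht : ∀ x : G ⧸ E, x ∈ Subgroup.zpowers (t : G ⧸ E)) {m : ℕ} (hm : m ≠ 0) :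
    (Subgroup.zpowers (t ^ m)).FiniteIndex := by
  have hsurj : Function.Surjective
      (fun p : E × Fin m => ((p.1 * t ^ (p.2 : ℕ) : G) : G ⧸ Subgroup.zpowers (t ^ m))) := by
    intro x
    obtain ⟨x, rfl⟩ := QuotientGroup.mk_surjective x
    obtain ⟨e, he, j, rfl⟩ := exists_mem_mul_zpow ht x
    have hm' : (m : ℤ) ≠ 0 := by exact_mod_cast hm
    have h0 := Int.emod_nonneg j hm'
    refine ⟨(⟨e, he⟩, ⟨(j % m).toNat, ?_⟩), ?_⟩
    · have := Int.emod_lt_of_pos j (by lia : (0 : ℤ) < m)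
      lia
    · refine QuotientGroup.eq.2 (Subgroup.mem_zpowers_iff.2 ⟨j / m, ?_⟩)
      have h1 : t ^ (j % m).toNat = t ^ (j % m) := by
        rw [← zpow_natCast, Int.toNat_of_nonneg h0]
      have h2 : t ^ j = t ^ (j % m) * (t ^ m) ^ (j / m) := by
        rw [← zpow_natCast t m, ← zpow_mul, ← zpow_add, Int.emod_add_mul_ediv]
      simp only [h1, h2]
      group
  have : Finite (G ⧸ Subgroup.zpowers (t ^ m)) := Finite.of_surjective _ hsurj
  exact Subgroup.finiteIndex_of_finite_quotient

theorem residuallyFinite_of_finite_of_isCyclic_quotient {G : Type*} [Group G] (E : Subgroup G)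
    [E.Normal] [Finite E] [IsCyclic (G ⧸ E)] : Group.ResiduallyFinite G := by
  obtain ⟨t', ht⟩ := IsCyclic.exists_generator (α := G ⧸ E)
  obtain ⟨t, rfl⟩ := QuotientGroup.mk_surjective t'
  rw [Group.residuallyFinite_iff_exists_finiteIndex]
  intro g hg
  suffices ∃ m : ℕ, m ≠ 0 ∧ g ∉ Subgroup.zpowers (t ^ m) by
    obtain ⟨m, hm, hgm⟩ := this
    exact ⟨_, finiteIndex_zpowers_pow ht hm, hgm⟩
  by_cases hfin : IsOfFinOrder t
  · exact ⟨orderOf t, hfin.orderOf_pos.ne', by simpa [pow_orderOf_eq_one] using hg⟩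
  by_cases hgt : g ∈ Subgroup.zpowers t
  · obtain ⟨i, rfl⟩ := Subgroup.mem_zpowers_iff.1 hgt
    refine ⟨i.natAbs + 1, by simp, fun hmem => ?_⟩
    obtain ⟨j, hj⟩ := Subgroup.mem_zpowers_iff.1 hmem
    rw [← zpow_natCast, ← zpow_mul] at hj
    have hij := injective_zpow_iff_not_isOfFinOrder.2 hfin hj
    have hi : i ≠ 0 := fun h => hg (by simp [h])
    have hdvd : i.natAbs + 1 ∣ i.natAbs := by
      refine ⟨j.natAbs, ?_⟩
      conv_lhs => rw [← hij]
      rw [Int.natAbs_mul, Int.natAbs_natCast]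
    exact absurd (Nat.le_of_dvd (Int.natAbs_pos.2 hi) hdvd) (by lia)
  · exact ⟨1, one_ne_zero, by simpa using hgt⟩

instance finite_monoidHom_of_fg {G F : Type*} [Group G] [Group F] [Group.FG G] [Finite F] :
    Finite (G →* F) := by
  obtain ⟨S, hS, hfin⟩ := Group.fg_iff.1 ‹Group.FG G›
  have := hfin.to_subtype
  refine Finite.of_injective (fun (f : G →* F) (s : S) => f s) fun f g h => ?_
  exact MonoidHom.eq_of_eqOn_dense hS fun s hs => congrFun h ⟨s, hs⟩

theorem Subgroup.FiniteIndex.exists_characteristic_le {G : Type*} [Group G] [Group.FG G]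
    (M : Subgroup G) [M.Normal] [M.FiniteIndex] :
    ∃ K ≤ M, K.Characteristic ∧ K.FiniteIndex := by
  refine ⟨⨅ f : G →* G ⧸ M, f.ker, ?_, ?_, ?_⟩
  · exact (iInf_le _ (QuotientGroup.mk' M)).trans (by simp)
  · refine Subgroup.characteristic_iff_le_comap.2 fun e x hx => ?_
    simp only [Subgroup.mem_comap, Subgroup.mem_iInf, MonoidHom.mem_ker] at hx ⊢
    exact fun f => hx (f.comp e.toMonoidHom)
  · exact Subgroup.finiteIndex_iInf fun f => Subgroup.finiteIndex_ker f

theorem finite_map_mk_map_subtype {G : Type*} [Group G] (N : Subgroup G) (K : Subgroup N)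
    [K.Normal] [K.FiniteIndex] [(K.map N.subtype).Normal] :
    Finite (N.map (QuotientGroup.mk' (K.map N.subtype))) := by
  refine Finite.of_surjective (QuotientGroup.lift K
    ((QuotientGroup.mk' (K.map N.subtype)).subgroupMap N) fun x hx => ?_) ?_
  · exact Subtype.ext ((QuotientGroup.eq_one_iff _).2 (Subgroup.mem_map_of_mem N.subtype hx))
  · exact QuotientGroup.lift_surjective_of_surjective _ _
      (MonoidHom.subgroupMap_surjective _ _) _

theorem Group.ResiduallyFinite.of_cyclic_extension {G : Type*} [Group G] (N : Subgroup G)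
    [N.Normal] [IsCyclic (G ⧸ N)] [Group.FG N] [Group.ResiduallyFinite N] :
    Group.ResiduallyFinite G := by
  rw [Group.residuallyFinite_iff_exists_finiteIndex]
  intro g hg
  obtain ⟨K, hKchar, hKfin, hgK⟩ : ∃ K : Subgroup N, K.Characteristic ∧ K.FiniteIndex ∧
      g ∉ K.map N.subtype := by
    by_cases hgN : g ∈ N
    · obtain ⟨M, hM⟩ := Group.exists_finiteIndexNormalSubgroup_notMem (⟨g, hgN⟩ : N)
        (by simpa [Subtype.ext_iff] using hg)
      obtain ⟨K, hKM, hK, hK'⟩ :=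
        Subgroup.FiniteIndex.exists_characteristic_le M.toSubgroup
      refine ⟨K, hK, hK', ?_⟩
      rintro ⟨x, hx, rfl⟩
      exact hM (hKM hx)
    · refine ⟨⊤, inferInstance, inferInstance, ?_⟩
      rintro ⟨x, -, rfl⟩
      exact hgN x.2
  set K' := K.map N.subtype
  have hK' : K'.Normal := inferInstance
  have hKN : K' ≤ N := Subgroup.map_subtype_le K
  let E := N.map (QuotientGroup.mk' K')
  have hE : E.Normal := Subgroup.Normal.map inferInstance _ (QuotientGroup.mk'_surjective _)
  have : Finite E := finite_map_mk_map_subtype N K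
  have : IsCyclic ((G ⧸ K') ⧸ E) :=
    isCyclic_of_surjective (QuotientGroup.quotientQuotientEquivQuotient K' N hKN).symm
      (MulEquiv.surjective _)
  have := residuallyFinite_of_finite_of_isCyclic_quotient E
  obtain ⟨H, hH⟩ := Group.exists_finiteIndexNormalSubgroup_notMem (g : G ⧸ K')
    (by rwa [Ne, QuotientGroup.eq_one_iff])
  exact ⟨(H.comap (QuotientGroup.mk' K')).toSubgroup, inferInstance, hH⟩

namespace IsIteratedCyclicExtension

universe u

variable {G : Type u} [Group G]

theorem fg (hG : IsIteratedCyclicExtension G) : Group.FG G := by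
  induction hG with
  | of_subsingleton G => infer_instance
  | of_extension G N hN ih => exact .of_cyclic_extension N ih

theorem residuallyFinite (hG : IsIteratedCyclicExtension G) : Group.ResiduallyFinite G := by
  induction hG with
  | of_subsingleton G => infer_instance
  | of_extension G N hN ih =>
    have := hN.fg
    exact .of_cyclic_extension N

end IsIteratedCyclicExtension

instance Int.isJacobsonRing : IsJacobsonRing ℤ := by
  refine isJacobsonRing_iff_prime_eq.2 fun P hP => ?_
  rcases eq_or_ne P ⊥ with rfl | hbot
  · refine (Submodule.eq_bot_iff _).2 fun x hx => ?_
    rcases Int.isUnit_iff.1 (Ideal.mem_jacobson_bot.1 hx x) with h | h <;> nlinarith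
  · have := hP.isMaximal hbot
    exact Ideal.jacobson_eq_self_of_isMaximal

open Polynomial in
/-- An orbit of an endomorphism of a finitely generated abelian group that never vanishes avoids
all multiples by a suitable nonzero integer. -/
theorem exists_forall_iterate_ne_zsmul {M : Type*} [AddCommGroup M] [Module.Finite ℤ M]
    (φ : Module.End ℤ M) (g : M) (hg : ∀ i : ℕ, (φ ^ i) g ≠ 0) :
    ∃ n : ℤ, n ≠ 0 ∧ ∀ (i : ℕ) (y : M), (φ ^ i) g ≠ n • y := by
  let ev : ℤ[X] →ₗ[ℤ] M := (LinearMap.applyₗ g).comp (aeval φ).toLinearMap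
  have ev_apply (p : ℤ[X]) : ev p = aeval φ p g := rfl
  let I : Ideal ℤ[X] :=
    { carrier := {p | ev p = 0}
      add_mem' := fun {a b} ha hb => by
        simp only [Set.mem_ofPred_eq] at ha hb ⊢
        rw [map_add, ha, hb, add_zero]
      zero_mem' := map_zero ev
      smul_mem' := fun q p hp => by
        simp only [Set.mem_ofPred_eq] at hp ⊢
        rw [ev_apply, smul_eq_mul, map_mul, Module.End.mul_apply, ← ev_apply p, hp, map_zero] }
  have mem_I (p : ℤ[X]) : p ∈ I ↔ ev p = 0 := Iff.rfl
  have hX : (X : ℤ[X]) ∉ I.jacobson := by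
    rw [← Ideal.radical_eq_jacobson]
    rintro ⟨i, hi⟩
    exact hg i (by simpa [mem_I, ev_apply] using hi)
  obtain ⟨P, hIP, hP, hXP⟩ : ∃ P : Ideal ℤ[X], I ≤ P ∧ P.IsMaximal ∧ (X : ℤ[X]) ∉ P := by
    simpa [Ideal.jacobson, Submodule.mem_sInf] using hX
  obtain ⟨p, hp, hp0⟩ : ∃ p : ℤ, C p ∈ P ∧ p ≠ 0 := by
    have hmax : (P.comap (C : ℤ →+* ℤ[X])).IsMaximal := isMaximal_comap_C_of_isJacobsonRing P
    have hbot : P.comap (C : ℤ →+* ℤ[X]) ≠ ⊥ := Ring.ne_bot_of_isMaximal_of_not_isField hmax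
      Int.not_isField
    obtain ⟨p, hp, hp0⟩ := Submodule.exists_mem_ne_zero_of_ne_bot hbot
    exact ⟨p, hp, hp0⟩
  let B : Submodule ℤ M := (P.restrictScalars ℤ).map ev
  have ev_mem_B {q : ℤ[X]} (hq : q ∈ P) : ev q ∈ B := Submodule.mem_map_of_mem hq
  have ev_X_pow (i : ℕ) : ev (X ^ i) = (φ ^ i) g := by simp [ev_apply]
  have orbit_notMem (i : ℕ) : (φ ^ i) g ∉ B := by
    rintro ⟨q, hq, hqi⟩
    have hsub : X ^ i - q ∈ I := by rw [mem_I, map_sub, ev_X_pow, hqi, sub_self]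
    have : X ^ i ∈ P := by simpa using P.add_mem (hIP hsub) hq
    exact hXP (hP.isPrime.mem_of_pow_mem i this)
  have smul_orbit_mem (i : ℕ) : p • (φ ^ i) g ∈ B := by
    rw [← ev_X_pow, ← map_smul]
    refine ev_mem_B ?_
    rw [smul_eq_C_mul]
    exact P.mul_mem_right _ hp
  obtain ⟨e, he, he0⟩ := Submodule.annihilator_top_inter_nonZeroDivisors
    (Submodule.torsion_isTorsion (R := ℤ) (M := M ⧸ B))
  have he0 : e ≠ 0 := nonZeroDivisors.ne_zero he0
  refine ⟨e, he0, fun i y hy => orbit_notMem i ?_⟩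
  have htors : B.mkQ y ∈ Submodule.torsion ℤ (M ⧸ B) := by
    refine Submodule.mem_torsion_iff _ |>.2
      ⟨⟨p * e, mem_nonZeroDivisors_of_ne_zero (mul_ne_zero hp0 he0)⟩, ?_⟩
    rw [Submonoid.mk_smul, ← map_smul, mul_smul, ← hy]
    exact (Submodule.Quotient.mk_eq_zero B).2 (smul_orbit_mem i)
  have hey := Submodule.mem_annihilator.1 he ⟨_, htors⟩ Submodule.mem_top
  rw [hy]
  refine (Submodule.Quotient.mk_eq_zero B).1 ?_
  simpa [Subtype.ext_iff] using hey

theorem IsPolycyclic.isIteratedCyclicExtension {G : Type*} [Group G] (hG : IsPolycyclic G) :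
    IsIteratedCyclicExtension G := by
  obtain ⟨m, H, h0, hm, hstep⟩ := hG
  have key (i : Fin (m + 1)) : IsIteratedCyclicExtension (H i) := by
    induction i using Fin.induction with
    | zero =>
      rw [h0]
      exact .of_subsingleton _
    | succ i ih =>
      obtain ⟨hle, hn, hcyc⟩ := hstep i
      refine .of_extension _ ((H i.castSucc).subgroupOf (H i.succ)) ?_
      exact ih.of_injective (Subgroup.subgroupOfEquivOfLe hle).toMonoidHom
        (Subgroup.subgroupOfEquivOfLe hle).injective
  have htop := key (Fin.last m)
  rw [hm] at htop
  exact htop.of_surjective (Subgroup.topEquiv (G := G)).toMonoidHom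
    (Subgroup.topEquiv (G := G)).surjective

theorem Group.ResiduallyFinite.exists_finiteIndex_of_finite {G : Type*} [Group G]
    [Group.ResiduallyFinite G] {S : Set G} (hS : S.Finite) :
    ∃ N : Subgroup G, N.Normal ∧ N.FiniteIndex ∧ ∀ s ∈ S, s ∈ N → s = 1 := by
  have hsep (s : G) : ∃ H : FiniteIndexNormalSubgroup G, s ∈ H → s = 1 := by
    by_cases hs : s = 1
    · exact ⟨.ofSubgroup ⊤, fun _ => hs⟩
    · obtain ⟨H, hH⟩ := Group.exists_finiteIndexNormalSubgroup_notMem s hs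
      exact ⟨H, fun h => absurd h hH⟩
  choose f hf using hsep
  have := hS.to_subtype
  refine ⟨⨅ s : S, (f s).toSubgroup, Subgroup.normal_iInf_normal fun s => inferInstance,
    Subgroup.finiteIndex_iInf fun s => inferInstance, fun s hs hmem => hf s ?_⟩
  exact (Subgroup.mem_iInf.1 hmem) ⟨s, hs⟩

theorem exists_forall_iterate_ne_zpow {A : Type*} [CommGroup A] [Group.FG A] (φ : A →* A) (g : A)
    (hg : ∀ i : ℕ, φ^[i] g ≠ 1) : ∃ n : ℤ, n ≠ 0 ∧ ∀ (i : ℕ) (y : A), φ^[i] g ≠ y ^ n := by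
  have : Module.Finite ℤ (Additive A) := Module.Finite.iff_addGroup_fg.2 inferInstance
  let Φ : Module.End ℤ (Additive A) := φ.toAdditive.toIntLinearMap
  have hΦ (i : ℕ) : (Φ ^ i) (.ofMul g) = .ofMul (φ^[i] g) := by
    rw [Module.End.pow_apply]
    have h : Function.Semiconj Additive.ofMul φ Φ := fun _ => rfl
    exact (h.iterate_right i g).symm
  obtain ⟨n, hn, h⟩ := exists_forall_iterate_ne_zsmul Φ (.ofMul g) fun i hi => hg i <| by
    rw [hΦ] at hi
    exact hi
  refine ⟨n, hn, fun i y hy => h i (.ofMul y) ?_⟩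
  rw [hΦ, hy, ofMul_zpow]

theorem iterate_mem_of_le_comap {G : Type*} [Group G] {A : Subgroup G} {φ : G →* G}
    (hφ : A ≤ A.comap φ) {g : G} (hg : g ∈ A) (i : ℕ) : φ^[i] g ∈ A := by
  induction i with
  | zero => exact hg
  | succ i ih =>
    rw [Function.iterate_succ_apply']
    exact hφ ih

namespace IsIteratedCyclicExtension

universe u

variable {G : Type u} [Group G]

open scoped IsMulCommutative in
/-- A never trivial orbit in an invariant abelian normal subgroup avoids a normal subgroup of
finite index. -/
theorem exists_finiteIndex_forall_iterate_notMem (hG : IsIteratedCyclicExtension G)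
    (A : Subgroup G) [A.Normal] [IsMulCommutative A] (φ : G →* G) (hφ : A ≤ A.comap φ) {g : G}
    (hgA : g ∈ A) (hg : ∀ i : ℕ, φ^[i] g ≠ 1) :
    ∃ N : Subgroup G, N.Normal ∧ N.FiniteIndex ∧ ∀ i : ℕ, φ^[i] g ∉ N := by
  have hfg : Group.FG A := (hG.subgroup A).fg
  let ψ : A →* A := (φ.comp A.subtype).codRestrict A fun x => hφ x.2
  have hψ (i : ℕ) : (ψ^[i] ⟨g, hgA⟩ : A) = φ^[i] g :=
    Function.Semiconj.iterate_right
      (show Function.Semiconj A.subtype ψ φ from fun _ => rfl) i ⟨g, hgA⟩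
  obtain ⟨n, hn, hpow⟩ := exists_forall_iterate_ne_zpow (A := A) ψ ⟨g, hgA⟩ fun i hi => hg i <| by
    rw [← hψ, hi, Subgroup.coe_one]
  let P : Subgroup A := (zpowGroupHom n).range
  have hchar : P.Characteristic := by
    refine Subgroup.characteristic_iff_map_le.2 fun e => ?_
    rintro _ ⟨_, ⟨x, rfl⟩, rfl⟩
    exact ⟨e x, by simp [zpowGroupHom]⟩
  have hPfin : P.FiniteIndex := by
    have : Finite (A ⧸ P) := by
      refine CommGroup.finite_of_fg_isMulTorsion (G := A ⧸ P) ?_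
      intro x
      obtain ⟨x, rfl⟩ := QuotientGroup.mk_surjective x
      refine isOfFinOrder_iff_zpow_eq_one.2 ⟨n, hn, ?_⟩
      rw [← QuotientGroup.mk_zpow, QuotientGroup.eq_one_iff]
      exact ⟨x, rfl⟩
    exact Subgroup.finiteIndex_of_finite_quotient
  let B := P.map A.subtype
  have hB : B.Normal := inferInstance
  have hfin : Finite (A.map (QuotientGroup.mk' B)) := finite_map_mk_map_subtype A P
  have := (hG.quotient B).residuallyFinite
  obtain ⟨N, hN, hNfin, hNA⟩ := Group.ResiduallyFinite.exists_finiteIndex_of_finite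
    (Set.toFinite (A.map (QuotientGroup.mk' B) : Set (G ⧸ B)))
  refine ⟨N.comap (QuotientGroup.mk' B), inferInstance, ?_, fun i hi => ?_⟩
  · exact (FiniteIndexNormalSubgroup.comap (QuotientGroup.mk' B)
      (.ofSubgroup N)).isFiniteIndex'
  · have h1 := hNA _ (Subgroup.mem_map_of_mem _ (iterate_mem_of_le_comap hφ hgA i)) hi
    obtain ⟨_, ⟨y, rfl⟩, hy⟩ := (QuotientGroup.eq_one_iff _).1 h1
    exact hpow i y (Subtype.ext ((hψ i).trans hy.symm))

theorem propertyP_of_derivedSeries_eq_bot (n : ℕ) :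
    ∀ {G : Type u} [Group G], IsIteratedCyclicExtension G → derivedSeries G n = ⊥ →
      ∀ φ : G →* G, PropertyP φ := by
  induction n with
  | zero =>
    intro G _ _ hn φ g
    have : Subsingleton G := Subgroup.subsingleton_iff.1 (subsingleton_of_bot_eq_top hn.symm)
    exact ⟨⊤, inferInstance, inferInstance, fun i => by simp [eq_iff_true_of_subsingleton]⟩
  | succ n ih =>
    intro G _ hG hn φ g
    let A := derivedSeries G n
    have hφ : A ≤ A.comap φ :=
      Subgroup.map_le_iff_le_comap.1 (map_derivedSeries_le_derivedSeries φ n)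
    by_cases hA : ∃ k : ℕ, φ^[k] g ∈ A
    · obtain ⟨k, hk⟩ := hA
      have := hG.residuallyFinite
      by_cases htriv : ∃ l : ℕ, φ^[l] g = 1
      · obtain ⟨l, hl⟩ := htriv
        obtain ⟨N, hN, hNfin, hNS⟩ := Group.ResiduallyFinite.exists_finiteIndex_of_finite
          ((Set.finite_lt_nat l).image fun i => φ^[i] g)
        refine ⟨N, hN, hNfin, fun i => ⟨fun hi => ?_, fun hi => hi ▸ N.one_mem⟩⟩
        rcases lt_or_ge i l with hil | hil
        · exact hNS _ ⟨i, hil, rfl⟩ hi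
        · obtain ⟨j, rfl⟩ := Nat.exists_eq_add_of_le' hil
          rw [Function.iterate_add_apply, hl, iterate_map_one]
      · push Not at htriv
        have hcomm : IsMulCommutative A := by
          rw [← Subgroup.le_centralizer_iff_isMulCommutative]
          exact Subgroup.commutator_eq_bot_iff_le_centralizer.1 hn
        obtain ⟨N₁, hN₁, hN₁fin, hN₁orbit⟩ :=
          hG.exists_finiteIndex_forall_iterate_notMem A φ hφ hk fun i => by
            rw [← Function.iterate_add_apply]
            exact htriv _
        obtain ⟨N₂, hN₂, hN₂fin, hN₂S⟩ := Group.ResiduallyFinite.exists_finiteIndex_of_finite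
          ((Set.finite_lt_nat k).image fun i => φ^[i] g)
        refine ⟨N₁ ⊓ N₂, inferInstance, inferInstance, fun i =>
          ⟨fun hi => ?_, fun hi => hi ▸ one_mem _⟩⟩
        rcases lt_or_ge i k with hik | hik
        · exact hN₂S _ ⟨i, hik, rfl⟩ hi.2
        · obtain ⟨j, rfl⟩ := Nat.exists_eq_add_of_le' hik
          rw [Function.iterate_add_apply] at hi
          exact absurd hi.1 (hN₁orbit j)
    · push Not at hA
      have hAn : derivedSeries (G ⧸ A) n = ⊥ := by
        rw [← map_derivedSeries_eq (QuotientGroup.mk'_surjective A), Subgroup.map_eq_bot_iff,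
          QuotientGroup.ker_mk']
      let ψ := QuotientGroup.map A A φ hφ
      have hψ (i : ℕ) : QuotientGroup.mk' A (φ^[i] g) = ψ^[i] (g : G ⧸ A) :=
        Function.Semiconj.iterate_right
          (show Function.Semiconj (QuotientGroup.mk' A) φ ψ from fun _ => rfl) i g
      obtain ⟨N, hN, hNfin, hNψ⟩ := ih (hG.quotient A) hAn ψ (g : G ⧸ A)
      refine ⟨N.comap (QuotientGroup.mk' A), inferInstance,
        (FiniteIndexNormalSubgroup.comap (QuotientGroup.mk' A) (.ofSubgroup N)).isFiniteIndex',
        fun i => ⟨fun hi => absurd ?_ (hA i), fun hi => hi ▸ one_mem _⟩⟩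
      rw [Subgroup.mem_comap, hψ, hNψ, ← hψ] at hi
      exact (QuotientGroup.eq_one_iff _).1 hi

end IsIteratedCyclicExtension

/-- Every endomorphism of a polycyclic group has property 𝔓. -/
theorem statement16 {G : Type*} [Group G] (hpc : IsPolycyclic G) (φ : G →* G) :
    PropertyP φ := by
  have hG := hpc.isIteratedCyclicExtension
  obtain ⟨n, hn⟩ := hG.isSolvable
  exact IsIteratedCyclicExtension.propertyP_of_derivedSeries_eq_bot n hG hn φ
end

section
/- If G is a polycyclic group and φ : G → G is an injective homomorphism, then the ascending HNN extension G_φ is highly residually finite. -/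
universe u v

/-- `IsPolyZ n G` says that `G` has a subnormal series of length `n` whose factors are trivial or
infinite cyclic. -/
def IsPolyZ : ℕ → ∀ (G : Type u) [Group G], Prop
  | 0, G, _ => Subsingleton G
  | n + 1, G, _ => ∃ f : G →* Multiplicative ℤ, IsPolyZ n f.ker

/-- The restriction of a homomorphism to the kernels of `g ∘ f` and `g`. -/
def kerMap {G : Type*} {H : Type*} {K : Type*} [Group G] [Group H] [Group K] (f : G →* H)
    (g : H →* K) : (g.comp f).ker →* g.ker :=
  (f.comp (g.comp f).ker.subtype).codRestrict g.ker fun x => x.2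

theorem kerMap_injective {G : Type*} {H : Type*} {K : Type*} [Group G] [Group H] [Group K]
    {f : G →* H} (hf : Function.Injective f) (g : H →* K) : Function.Injective (kerMap f g) :=
  fun _ _ h => Subtype.ext (hf (congrArg Subtype.val h))

theorem ker_le_ker_of_comp_subtype_eq_one {G : Type*} [Group G] {f g : G →* Multiplicative ℤ}
    (hf : f ≠ 1) (hfg : f.comp g.ker.subtype = 1) : f.ker ≤ g.ker := by
  intro x hx
  obtain ⟨y, hy⟩ : ∃ y, f y ≠ 1 := by
    by_contra! hc
    exact hf (MonoidHom.ext hc)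
  have hz : x ^ (g y).toAdd * y ^ (-(g x).toAdd) ∈ g.ker := by
    rw [MonoidHom.mem_ker, map_mul, map_zpow, map_zpow]
    apply Multiplicative.toAdd.injective
    simp only [toAdd_mul, toAdd_zpow, toAdd_one, smul_eq_mul]
    ring
  have h2 := congrArg Multiplicative.toAdd (DFunLike.congr_fun hfg ⟨_, hz⟩)
  have hx' : f x = 1 := hx
  have hy' : (f y).toAdd ≠ 0 := by simpa using hy
  simpa [hx', hy'] using h2

namespace IsPolyZ

theorem of_injective {n : ℕ} {G : Type u} {H : Type v} [Group G] [Group H] (h : IsPolyZ n H)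
    {f : G →* H} (hf : Function.Injective f) : IsPolyZ n G := by
  induction n generalizing G H with
  | zero =>
    have : Subsingleton H := h
    exact hf.subsingleton
  | succ n ih =>
    obtain ⟨g, hg⟩ := h
    exact ⟨g.comp f, ih hg (kerMap_injective hf g)⟩

theorem mono_subgroup {n : ℕ} {G : Type*} [Group G] {H K : Subgroup G} (h : IsPolyZ n K)
    (hle : H ≤ K) : IsPolyZ n H :=
  h.of_injective (Subgroup.inclusion_injective hle)

theorem ker_of_ne_one {n : ℕ} {G : Type*} [Group G] (h : IsPolyZ (n + 1) G)
    {f : G →* Multiplicative ℤ} (hf : f ≠ 1) : IsPolyZ n f.ker := by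
  induction n generalizing G with
  | zero =>
    obtain ⟨g, hg⟩ := h
    refine hg.mono_subgroup (ker_le_ker_of_comp_subtype_eq_one hf (MonoidHom.ext fun x => ?_))
    have : Subsingleton g.ker := hg
    rw [Subsingleton.elim x 1, map_one, map_one]
  | succ n ih =>
    obtain ⟨g, hg⟩ := h
    by_cases hfg : f.comp g.ker.subtype = 1
    · exact hg.mono_subgroup (ker_le_ker_of_comp_subtype_eq_one hf hfg)
    · exact ⟨g.comp f.ker.subtype, (ih hg hfg).of_injective
        (f := (((f.ker.subtype.comp (g.comp f.ker.subtype).ker.subtype).codRestrict g.ker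
          fun x => x.2).codRestrict (f.comp g.ker.subtype).ker fun x => x.1.2))
        fun x y hxy => Subtype.ext (Subtype.ext (congrArg (fun z => z.1.1) hxy))⟩

theorem eq_one_of_isOfFinOrder {n : ℕ} {G : Type*} [Group G] (h : IsPolyZ n G) {g : G}
    (hg : IsOfFinOrder g) : g = 1 := by
  induction n generalizing G with
  | zero =>
    have : Subsingleton G := h
    exact Subsingleton.elim _ _
  | succ n ih =>
    obtain ⟨f, hf⟩ := h
    have hgf : f g = 1 := (isOfFinOrder_iff_eq_one _).1 (f.isOfFinOrder hg)
    have := ih hf (g := ⟨g, hgf⟩) (f.ker.subtype_injective.isOfFinOrder_iff.1 hg)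
    exact congrArg Subtype.val this

end IsPolyZ

theorem Group.fg_of_fg_ker_range {G : Type*} {H : Type*} [Group G] [Group H] (f : G →* H)
    [hk : Group.FG f.ker] [hr : Group.FG f.range] : Group.FG G := by
  classical
  rw [Group.fg_iff] at hr
  obtain ⟨S, hS, hfin⟩ := hr
  have hker : f.ker.FG := (Group.fg_iff_subgroup_fg _).1 hk
  choose s hs using fun x : f.range => x.2
  rw [Group.fg_def]
  have : f.ker ⊔ Subgroup.closure (s '' S) = ⊤ := by
    rw [eq_top_iff]
    have h1 : (Subgroup.closure (s '' S)).map f.rangeRestrict = ⊤ := by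
      have : f.rangeRestrict ∘ s = id := funext fun x => Subtype.ext (hs x)
      rw [MonoidHom.map_closure, ← Set.image_comp, this, Set.image_id, hS]
    intro x _
    obtain ⟨y, hy, hxy⟩ : f.rangeRestrict x ∈ (Subgroup.closure (s '' S)).map f.rangeRestrict :=
      h1 ▸ Subgroup.mem_top _
    have hxy : f y = f x := congrArg Subtype.val hxy
    have : x * y⁻¹ ∈ f.ker := by simp [MonoidHom.mem_ker, hxy]
    simpa using Subgroup.mul_mem_sup this hy
  rw [← this]
  exact hker.sup ((Subgroup.fg_iff _).2 ⟨_, rfl, hfin.image _⟩)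

theorem IsPolyZ.fg {n : ℕ} {G : Type*} [Group G] (h : IsPolyZ n G) : Group.FG G := by
  induction n generalizing G with
  | zero =>
    have : Subsingleton G := h
    infer_instance
  | succ n ih =>
    obtain ⟨f, hf⟩ := h
    have := ih hf
    have : Group.FG f.range := by
      obtain ⟨g, hg⟩ := (inferInstance : IsCyclic f.range)
      rw [Group.fg_iff]
      refine ⟨{g}, ?_, Set.finite_singleton _⟩
      rw [← Subgroup.zpowers_eq_closure]
      exact (Subgroup.eq_top_iff' _).2 hg
    exact Group.fg_of_fg_ker_range f

theorem MonoidHom.finite_of_fg (G : Type*) (K : Type*) [Group G] [Group K] [hG : Group.FG G]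
    [Finite K] : Finite (G →* K) := by
  obtain ⟨S, hS, hfin⟩ := Group.fg_iff.1 hG
  have : Finite S := hfin
  exact Finite.of_injective (fun (f : G →* K) (s : S) => f s) fun f g h =>
    MonoidHom.eq_of_eqOn_dense hS fun x hx => congrFun h ⟨x, hx⟩

/-- The intersection of the kernels of all actions of `G` on `n` points. -/
def permCore (n : ℕ) (G : Type*) [Group G] : Subgroup G :=
  ⨅ f : G →* Equiv.Perm (Fin n), f.ker

theorem mem_permCore {n : ℕ} {G : Type*} [Group G] {x : G} :
    x ∈ permCore n G ↔ ∀ f : G →* Equiv.Perm (Fin n), f x = 1 := by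
  simp [permCore, Subgroup.mem_iInf, MonoidHom.mem_ker]

theorem map_mem_permCore {n : ℕ} {G : Type*} {H : Type*} [Group G] [Group H] (f : G →* H) {x : G}
    (hx : x ∈ permCore n G) : f x ∈ permCore n H :=
  mem_permCore.2 fun g => mem_permCore.1 hx (g.comp f)

instance permCore_characteristic (n : ℕ) (G : Type*) [Group G] :
    (permCore n G).Characteristic :=
  Subgroup.characteristic_iff_le_comap.2 fun e _ hx => map_mem_permCore e.toMonoidHom hx

instance permCore_finiteIndex (n : ℕ) (G : Type*) [Group G] [Group.FG G] :
    (permCore n G).FiniteIndex :=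
  have := MonoidHom.finite_of_fg G (Equiv.Perm (Fin n))
  Subgroup.finiteIndex_iInf fun _ => inferInstance

theorem map_eq_one_of_mem_permCore {G : Type*} {α : Type*} [Group G] [Finite α]
    (f : G →* Equiv.Perm α) {x : G} (hx : x ∈ permCore (Nat.card α) G) : f x = 1 := by
  have h := mem_permCore.1 hx ((Finite.equivFin α).permCongrHom.toMonoidHom.comp f)
  exact (Finite.equivFin α).permCongrHom.injective (h.trans (map_one _).symm)

theorem map_eq_one_of_mem_permCore_card {G : Type*} {K : Type*} [Group G] [Group K] [Finite K]
    (f : G →* K) {x : G} (hx : x ∈ permCore (Nat.card K) G) : f x = 1 :=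
  MulAction.toPerm_injective (α := K) (β := K) <|
    (map_eq_one_of_mem_permCore ((MulAction.toPermHom K K).comp f) hx).trans
      (map_one (MulAction.toPermHom K K)).symm

theorem permCore_index_le {G : Type*} [Group G] (H : Subgroup G) [H.FiniteIndex] :
    permCore H.index G ≤ H := fun x hx => by
  have h := map_eq_one_of_mem_permCore (MulAction.toPermHom G (G ⧸ H)) hx
  rw [← MonoidHom.mem_ker, ← Subgroup.normalCore_eq_ker] at h
  exact H.normalCore_le h

/-- A group is virtually poly-`ℤ` if some subgroup of finite index satisfies `IsPolyZ`. -/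
def IsVirtuallyPolyZ (G : Type*) [Group G] : Prop :=
  ∃ (L : Subgroup G) (n : ℕ), L.FiniteIndex ∧ IsPolyZ n L

theorem Subgroup.isPolyZ_map {n : ℕ} {G : Type*} {H : Type*} [Group G] [Group H] {L : Subgroup G}
    (h : IsPolyZ n L) {f : G →* H} (hf : Function.Injective f) : IsPolyZ n (L.map f) :=
  h.of_injective (f := (L.equivMapOfInjective f hf).symm.toMonoidHom) (MulEquiv.injective _)

theorem Subgroup.finiteIndex_comap {G : Type*} {H : Type*} [Group G] [Group H] (L : Subgroup H)
    [L.FiniteIndex] (f : G →* H) : (L.comap f).FiniteIndex :=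
  ⟨by
    rw [Subgroup.index_comap]
    exact Subgroup.FiniteIndex.index_ne_zero⟩

theorem Subgroup.finiteIndex_map_subtype {G : Type*} [Group G] {H : Subgroup G} {L : Subgroup H}
    [H.FiniteIndex] [L.FiniteIndex] : (L.map H.subtype).FiniteIndex :=
  ⟨by
    rw [Subgroup.index_map_subtype]
    exact mul_ne_zero Subgroup.FiniteIndex.index_ne_zero Subgroup.FiniteIndex.index_ne_zero⟩

namespace IsVirtuallyPolyZ

theorem of_finite (G : Type*) [Group G] [Finite G] : IsVirtuallyPolyZ G :=
  ⟨⊥, 0, inferInstance, (inferInstance : Subsingleton (⊥ : Subgroup G))⟩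

theorem of_injective {G : Type*} {H : Type*} [Group G] [Group H] (h : IsVirtuallyPolyZ H)
    {f : G →* H} (hf : Function.Injective f) : IsVirtuallyPolyZ G := by
  obtain ⟨L, n, hL, hn⟩ := h
  refine ⟨L.comap f, n, L.finiteIndex_comap f,
    hn.of_injective (f := f.subgroupComap L) fun x y hxy => ?_⟩
  exact Subtype.ext (hf (congrArg Subtype.val hxy))

theorem of_finiteIndex {G : Type*} [Group G] {H : Subgroup G} [H.FiniteIndex]
    (h : IsVirtuallyPolyZ H) : IsVirtuallyPolyZ G := by
  obtain ⟨L, n, hL, hn⟩ := h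
  exact ⟨L.map H.subtype, n, Subgroup.finiteIndex_map_subtype,
    Subgroup.isPolyZ_map hn H.subtype_injective⟩

theorem fg {G : Type*} [Group G] (h : IsVirtuallyPolyZ G) : Group.FG G := by
  obtain ⟨L, n, hL, hn⟩ := h
  have : Group.FG (QuotientGroup.mk' L.normalCore).ker := by
    rw [QuotientGroup.ker_mk']
    exact (hn.mono_subgroup L.normalCore_le).fg
  exact Group.fg_of_fg_ker_range (QuotientGroup.mk' L.normalCore)

theorem exists_permCore {G : Type*} [Group G] (h : IsVirtuallyPolyZ G) :
    ∃ m n, IsPolyZ n (permCore m G) := by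
  obtain ⟨L, n, hL, hn⟩ := h
  exact ⟨L.index, n, hn.mono_subgroup (permCore_index_le L)⟩

theorem of_ker_of_map_eq_ofAdd_one {G : Type*} [Group G] {f : G →* Multiplicative ℤ} {s : G}
    (hs : f s = Multiplicative.ofAdd 1) (h : IsVirtuallyPolyZ f.ker) : IsVirtuallyPolyZ G := by
  have := h.fg
  obtain ⟨m, n, hn⟩ := h.exists_permCore
  set L₁ := permCore m f.ker
  set L : Subgroup G := L₁.map f.ker.subtype
  have hLn : IsPolyZ n L := Subgroup.isPolyZ_map hn f.ker.subtype_injective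
  have hLnorm : L.Normal := inferInstance
  have hLker : L ≤ f.ker := Subgroup.map_subtype_le _
  refine ⟨L ⊔ Subgroup.zpowers s, n + 1, ?_, ?_⟩
  · have hsurj : Function.Surjective (Quotient.lift (s := QuotientGroup.leftRel L₁)
        (fun k : f.ker => (QuotientGroup.mk (k : G) : G ⧸ (L ⊔ Subgroup.zpowers s)))
        fun a b hab => by
          have hab := QuotientGroup.leftRel_apply.1 hab
          rw [QuotientGroup.eq]
          exact Subgroup.mem_sup_left ⟨_, hab, rfl⟩) := by
      intro q
      obtain ⟨q, rfl⟩ := QuotientGroup.mk_surjective q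
      refine ⟨Quotient.mk _ ⟨q * s ^ (-(f q).toAdd), ?_⟩, ?_⟩
      · rw [MonoidHom.mem_ker, map_mul, map_zpow, hs]
        apply Multiplicative.toAdd.injective
        simp
      · rw [Quotient.lift_mk, QuotientGroup.eq]
        refine Subgroup.mem_sup_right ⟨(f q).toAdd, ?_⟩
        simp
    have : Finite (f.ker ⧸ L₁) := Subgroup.finite_quotient_of_finiteIndex
    have : Finite (G ⧸ (L ⊔ Subgroup.zpowers s)) := Finite.of_surjective _ hsurj
    exact Subgroup.finiteIndex_of_finite_quotient
  · refine ⟨f.comp (L ⊔ Subgroup.zpowers s).subtype, hLn.of_injective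
      (f := ((L ⊔ Subgroup.zpowers s).subtype.comp
        (f.comp (L ⊔ Subgroup.zpowers s).subtype).ker.subtype).codRestrict L ?_) ?_⟩
    · rintro ⟨⟨x, hx⟩, hxk⟩
      have hxk : f x = 1 := hxk
      obtain ⟨l, hl, y, ⟨j, rfl⟩, rfl⟩ := Subgroup.mem_sup_of_normal_left.1 hx
      have h1 : f l = 1 := hLker hl
      have hj := congrArg Multiplicative.toAdd hxk
      simp [h1, hs] at hj
      simpa [hj] using hl
    · intro x y hxy
      have hxy := congrArg Subtype.val hxy
      exact Subtype.ext (Subtype.ext hxy)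

theorem of_ker {G : Type*} {C : Type*} [Group G] [Group C] [IsCyclic C] (f : G →* C)
    (h : IsVirtuallyPolyZ f.ker) : IsVirtuallyPolyZ G := by
  cases finite_or_infinite f.range with
  | inl hfin => exact h.of_finiteIndex
  | inr hinf =>
    have hcyc : IsCyclic f.range := inferInstance
    let e : Multiplicative ℤ ≃* f.range := intCyclicMulEquiv
    obtain ⟨s, hs⟩ := f.rangeRestrict_surjective (e (Multiplicative.ofAdd 1))
    refine of_ker_of_map_eq_ofAdd_one (f := e.symm.toMonoidHom.comp f.rangeRestrict) (s := s)
      (by simp [hs]) ?_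
    have hle : (e.symm.toMonoidHom.comp f.rangeRestrict).ker ≤ f.ker := fun x hx => by
      have hx : e.symm (f.rangeRestrict x) = 1 := hx
      have := (map_eq_one_iff e.symm e.symm.injective).1 hx
      exact congrArg Subtype.val this
    exact h.of_injective (Subgroup.inclusion_injective hle)

end IsVirtuallyPolyZ

theorem IsPolyZ.isVirtuallyPolyZ_of_surjective {n : ℕ} {G : Type*} {H : Type*} [Group G] [Group H]
    (h : IsPolyZ n G) {π : G →* H} (hπ : Function.Surjective π) : IsVirtuallyPolyZ H := by
  induction n generalizing G H with
  | zero =>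
    have : Subsingleton G := h
    have := hπ.subsingleton
    exact .of_finite H
  | succ n ih =>
    obtain ⟨f, hf⟩ := h
    have hN : (f.ker.map π).Normal := Subgroup.Normal.map inferInstance π hπ
    have hker : IsVirtuallyPolyZ (f.ker.map π) := ih hf (π.subgroupMap_surjective f.ker)
    have hcyc : IsCyclic (H ⧸ f.ker.map π) := by
      have : IsCyclic (G ⧸ f.ker) :=
        isCyclic_of_injective (QuotientGroup.kerLift f) (QuotientGroup.kerLift_injective f)
      refine isCyclic_of_surjective
        (QuotientGroup.map f.ker (f.ker.map π) π (Subgroup.le_comap_map _ _)) ?_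
      exact QuotientGroup.map_surjective_of_surjective _ _ _
        (QuotientGroup.mk_surjective.comp hπ) _
    refine IsVirtuallyPolyZ.of_ker (QuotientGroup.mk' (f.ker.map π)) ?_
    rwa [QuotientGroup.ker_mk']

theorem exists_permCore_notMem {G : Type*} [Group G] {ψ : G →* G} {p : G} (D : Subgroup G)
    [D.FiniteIndex] (h : ∀ k, ∃ j, ψ^[j] (ψ^[k] p) ∉ D) :
    ∃ m, ∀ k, ψ^[k] p ∉ permCore m G := by
  refine ⟨D.index, fun k hk => ?_⟩
  obtain ⟨j, hj⟩ := h k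
  have key : ∀ i, ψ^[i] (ψ^[k] p) ∈ permCore D.index G := fun i => by
    induction i with
    | zero => exact hk
    | succ i ih =>
      rw [Function.iterate_succ_apply']
      exact map_mem_permCore ψ ih
  exact hj (permCore_index_le D (key j))

theorem exists_pow_eq_comp {G : Type*} [Group G] [Group.FG G] {ψ : G →* G}
    (h : ∀ f : G →* Multiplicative ℤ, f.comp ψ = 1 → f = 1) :
    ∃ m : ℕ, m ≠ 0 ∧ ∀ f : G →* Multiplicative ℤ, ∃ f' : G →* Multiplicative ℤ,
      f'.comp ψ = f ^ m := by
  obtain ⟨S, hS, hfin⟩ := Group.fg_iff.1 ‹Group.FG G›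
  have : Finite S := hfin
  let M := Additive (G →* Multiplicative ℤ)
  let ev : M →ₗ[ℤ] (S → ℤ) := AddMonoidHom.toIntLinearMap
    { toFun := fun (f : M) (s : S) => (f.toMul (s : G)).toAdd
      map_zero' := rfl
      map_add' := fun _ _ => rfl }
  have hev : Function.Injective ev := fun f g hfg => by
    apply Additive.toMul.injective
    refine MonoidHom.eq_of_eqOn_dense hS fun x hx => ?_
    exact congrFun hfg ⟨x, hx⟩
  have : Module.Finite ℤ M := Module.Finite.of_injective ev hev
  have : Module.IsTorsionFree ℤ M :=
    Function.Injective.moduleIsTorsionFree ev hev fun c x => map_smul ev c x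
  have : Module.Free ℤ M := Module.free_of_finite_type_torsion_free'
  let T : M →ₗ[ℤ] M := (MonoidHom.toAdditive (MonoidHom.compHom' ψ)).toIntLinearMap
  have hT : Function.Injective T := by
    rw [← LinearMap.ker_eq_bot, LinearMap.ker_eq_bot']
    exact fun f hf => h f hf
  have hfinite : Finite (M ⧸ LinearMap.range T) :=
    Submodule.finiteQuotientOfFreeOfRankEq _ (LinearMap.finrank_range_of_inj hT)
  refine ⟨Nat.card (M ⧸ LinearMap.range T), Nat.card_pos.ne', fun f => ?_⟩
  have h0 : Nat.card (M ⧸ LinearMap.range T) •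
      (LinearMap.range T).mkQ (Additive.ofMul f) = 0 := card_nsmul_eq_zero'
  rw [← map_nsmul, Submodule.mkQ_apply, Submodule.Quotient.mk_eq_zero] at h0
  exact h0

theorem exists_permCore_notMem_of_map_ne_one {G : Type*} [Group G] [Group.FG G] {ψ : G →* G}
    (h : ∀ f : G →* Multiplicative ℤ, f.comp ψ = 1 → f = 1) {p : G} {f : G →* Multiplicative ℤ}
    (hf : f p ≠ 1) : ∃ m, ∀ k, ψ^[k] p ∉ permCore m G := by
  obtain ⟨m, hm, hcomp⟩ := exists_pow_eq_comp h
  obtain ⟨q, hqle, hq⟩ := Nat.exists_infinite_primes (m + (f p).toAdd.natAbs + 1)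
  have : NeZero q := ⟨hq.ne_zero⟩
  have hfp : (f p).toAdd.natAbs ≠ 0 := by simpa using hf
  have hpow : ∀ k, ∃ f' : G →* Multiplicative ℤ, f' (ψ^[k] p) = f p ^ m ^ k := fun k => by
    suffices H : ∀ g : G →* Multiplicative ℤ, ∃ f' : G →* Multiplicative ℤ,
        f' (ψ^[k] p) = g p ^ m ^ k from H f
    induction k with
    | zero => exact fun g => ⟨g, by simp⟩
    | succ k ih =>
      intro g
      obtain ⟨g₁, hg₁⟩ := ih g
      obtain ⟨g₂, hg₂⟩ := hcomp g₁
      refine ⟨g₂, ?_⟩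
      have := DFunLike.congr_fun hg₂ (ψ^[k] p)
      rw [Function.iterate_succ_apply']
      rw [MonoidHom.comp_apply] at this
      rw [this, MonoidHom.pow_apply, hg₁, ← pow_mul, pow_succ]
  refine ⟨Nat.card (Multiplicative (ZMod q)), fun k hk => ?_⟩
  obtain ⟨f', hf'⟩ := hpow k
  have h1 := map_eq_one_of_mem_permCore_card
    ((AddMonoidHom.toMultiplicative (Int.castAddHom (ZMod q))).comp f') hk
  rw [MonoidHom.comp_apply, hf'] at h1
  have h2 : (((m : ℤ) ^ k * (f p).toAdd : ℤ) : ZMod q) = 0 := by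
    have := congrArg Multiplicative.toAdd h1
    simpa using this
  rw [ZMod.intCast_zmod_eq_zero_iff_dvd] at h2
  have hq' : Prime (q : ℤ) := Nat.prime_iff_prime_int.1 hq
  rcases hq'.dvd_or_dvd h2 with h3 | h3
  · have := Nat.le_of_dvd (Nat.pos_of_ne_zero hm) (Int.natCast_dvd_natCast.1 (hq'.dvd_of_dvd_pow h3))
    omega
  · have := Nat.le_of_dvd (Nat.pos_of_ne_zero hfp) (Int.natCast_dvd.1 h3)
    omega

theorem IsPolyZ.exists_permCore_notMem {n : ℕ} {G : Type*} [Group G] (h : IsPolyZ n G)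
    {ψ : G →* G} (hψ : Function.Injective ψ) {p : G} (hp : p ≠ 1) :
    ∃ m, ∀ k, ψ^[k] p ∉ permCore m G := by
  induction n generalizing G with
  | zero =>
    have : Subsingleton G := h
    exact absurd (Subsingleton.elim _ _) hp
  | succ n ih =>
    by_cases hn : IsPolyZ n G
    · exact ih hn hψ hp
    have := h.fg
    have hcomp : ∀ f : G →* Multiplicative ℤ, f.comp ψ = 1 → f = 1 := fun f hf => by
      by_contra hne
      exact hn ((h.ker_of_ne_one hne).of_injective
        (f := ψ.codRestrict f.ker fun x => DFunLike.congr_fun hf x)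
        fun x y hxy => hψ (congrArg Subtype.val hxy))
    by_cases hex : ∃ f : G →* Multiplicative ℤ, f p ≠ 1
    · obtain ⟨f, hf⟩ := hex
      exact exists_permCore_notMem_of_map_ne_one hcomp hf
    push Not at hex
    set P : Subgroup G := ⨅ f : G →* Multiplicative ℤ, f.ker with hP
    have mem_P : ∀ {x}, x ∈ P ↔ ∀ f : G →* Multiplicative ℤ, f x = 1 := by
      simp [hP, Subgroup.mem_iInf, MonoidHom.mem_ker]
    have hPnorm : P.Normal := Subgroup.normal_iInf_normal fun f => inferInstance
    let ψ' : P →* P := (ψ.comp P.subtype).codRestrict P fun x =>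
      mem_P.2 fun f => mem_P.1 x.2 (f.comp ψ)
    have hPn : IsPolyZ n P := by
      obtain ⟨f, hf⟩ := h
      exact hf.mono_subgroup fun x hx => mem_P.1 hx f
    obtain ⟨m, hm⟩ := ih hPn (ψ := ψ') (p := ⟨p, mem_P.2 hex⟩)
      (fun x y hxy => Subtype.ext (hψ (congrArg Subtype.val hxy)))
      fun hc => hp (congrArg Subtype.val hc)
    have := hPn.fg
    obtain ⟨L, l, hL, hl⟩ := h.isVirtuallyPolyZ_of_surjective
      (QuotientGroup.mk'_surjective ((permCore m P).map P.subtype))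
    have := L.finiteIndex_comap (QuotientGroup.mk' ((permCore m P).map P.subtype))
    refine _root_.exists_permCore_notMem (L.comap (QuotientGroup.mk' _)) fun k => ⟨0, fun hk => ?_⟩
    have hval := ((show Function.Semiconj P.subtype ψ' ψ from fun _ => rfl).iterate_right k).eq
      ⟨p, mem_P.2 hex⟩
    specialize hm k
    set x : P := ψ'^[k] ⟨p, mem_P.2 hex⟩
    rw [Function.iterate_zero_apply] at hk
    replace hk : (x : G) ∈ L.comap (QuotientGroup.mk' ((permCore m P).map P.subtype)) :=
      (congrArg (· ∈ _) hval).mpr hk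
    have hfin : IsOfFinOrder (QuotientGroup.mk' ((permCore m P).map P.subtype) (x : G)) := by
      rw [isOfFinOrder_iff_pow_eq_one]
      refine ⟨(permCore m P).index, Nat.pos_of_ne_zero Subgroup.FiniteIndex.index_ne_zero, ?_⟩
      rw [← map_pow]
      exact (QuotientGroup.eq_one_iff _).2
        ⟨x ^ (permCore m P).index, (permCore m P).pow_index_mem x, rfl⟩
    have hone := hl.eq_one_of_isOfFinOrder
      (g := ⟨_, hk⟩) (L.subtype_injective.isOfFinOrder_iff.1 hfin)
    obtain ⟨y, hy, hyx⟩ := (QuotientGroup.eq_one_iff _).1 (congrArg Subtype.val hone)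
    exact hm (Subtype.ext hyx ▸ hy)

theorem IsVirtuallyPolyZ.exists_permCore_notMem {G : Type*} [Group G] (h : IsVirtuallyPolyZ G)
    {ψ : G →* G} (hψ : Function.Injective ψ) {p : G} (hp : p ≠ 1) :
    ∃ m, ∀ k, ψ^[k] p ∉ permCore m G := by
  have := h.fg
  obtain ⟨m, n, hn⟩ := h.exists_permCore
  by_cases hex : ∀ k, ψ^[k] p ∉ permCore m G
  · exact ⟨m, hex⟩
  push Not at hex
  obtain ⟨k₀, hk₀⟩ := hex
  set C := permCore m G
  let ψ' : C →* C := (ψ.comp C.subtype).codRestrict C fun x => map_mem_permCore ψ x.2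
  obtain ⟨l, hl⟩ := hn.exists_permCore_notMem (ψ := ψ') (p := ⟨_, hk₀⟩)
    (fun x y hxy => Subtype.ext (hψ (congrArg Subtype.val hxy)))
    fun hc => hp (hψ.iterate k₀ ((congrArg Subtype.val hc).trans (iterate_map_one ψ k₀).symm))
  have := hn.fg
  have := Subgroup.finiteIndex_map_subtype (H := C) (L := permCore l C)
  refine _root_.exists_permCore_notMem ((permCore l C).map C.subtype) fun k => ⟨k₀, ?_⟩
  rintro ⟨y, hy, hyx⟩
  have hval := ((show Function.Semiconj C.subtype ψ' ψ from fun _ => rfl).iterate_right k).eq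
    ⟨_, hk₀⟩
  have hy' : y = ψ'^[k] ⟨_, hk₀⟩ := by
    refine Subtype.ext (hyx.trans (Eq.trans ?_ hval.symm))
    rw [← Function.iterate_add_apply, add_comm, Function.iterate_add_apply]
    rfl
  exact hl k (hy' ▸ hy)

theorem IsVirtuallyPolyZ.residuallyFinite {G : Type*} [Group G] (h : IsVirtuallyPolyZ G) :
    ResiduallyFinite G := fun g hg => by
  have := h.fg
  obtain ⟨m, hm⟩ := h.exists_permCore_notMem (ψ := MonoidHom.id G) Function.injective_id hg
  exact ⟨permCore m G, inferInstance, inferInstance, hm 0⟩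

theorem ResiduallyFinite.exists_of_map_ne_one {G : Type*} {H : Type*} [Group G] [Group H]
    (h : ResiduallyFinite H) (f : G →* H) {g : G} (hg : f g ≠ 1) :
    ∃ N : Subgroup G, N.Normal ∧ N.FiniteIndex ∧ g ∉ N := by
  obtain ⟨N, hN, hfin, hgN⟩ := h _ hg
  exact ⟨N.comap f, inferInstance, N.finiteIndex_comap f, hgN⟩

theorem exists_normal_of_conj_mem {E : Type*} [Group E] {P N : Subgroup E} {t : E}
    (hPt : ∀ p ∈ P, t⁻¹ * p * t ∈ P) (hNt : ∀ x ∈ N, t⁻¹ * x * t ∈ N)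
    (hNP : ∀ p ∈ P, ∀ x ∈ N, p * x * p⁻¹ ∈ N)
    (hgen : ∀ e : E, ∃ (i j : ℕ), ∃ p ∈ P, e = t ^ i * p * (t ^ j)⁻¹) :
    ∃ M : Subgroup E, M.Normal ∧ ∀ x, x ∈ M ↔ ∃ k : ℕ, (t ^ k)⁻¹ * x * t ^ k ∈ N := by
  have hsucc : ∀ (k : ℕ) (x : E),
      (t ^ (k + 1))⁻¹ * x * t ^ (k + 1) = t⁻¹ * ((t ^ k)⁻¹ * x * t ^ k) * t := fun k x => by
    rw [pow_succ]; group
  have hpow : ∀ {S : Subgroup E}, (∀ x ∈ S, t⁻¹ * x * t ∈ S) → ∀ (k : ℕ), ∀ x ∈ S,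
      (t ^ k)⁻¹ * x * t ^ k ∈ S := fun hS k x hx => by
    induction k with
    | zero => simpa using hx
    | succ k ih => rw [hsucc]; exact hS _ ih
  have hadd : ∀ (k l : ℕ) (x : E), (t ^ k)⁻¹ * x * t ^ k ∈ N →
      (t ^ (k + l))⁻¹ * x * t ^ (k + l) ∈ N := fun k l x hx => by
    have := hpow hNt l _ hx
    rw [pow_add]
    simpa [mul_assoc] using this
  let M : Subgroup E :=
    { carrier := {x | ∃ k : ℕ, (t ^ k)⁻¹ * x * t ^ k ∈ N}
      one_mem' := ⟨0, by simp [N.one_mem]⟩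
      mul_mem' := by
        rintro x y ⟨k, hk⟩ ⟨l, hl⟩
        refine ⟨k + l, ?_⟩
        have := N.mul_mem (hadd k l x hk) (add_comm l k ▸ hadd l k y hl)
        simpa [mul_assoc] using this
      inv_mem' := by
        rintro x ⟨k, hk⟩
        exact ⟨k, by simpa [mul_assoc] using N.inv_mem hk⟩ }
  have hM : ∀ x, x ∈ M ↔ ∃ k : ℕ, (t ^ k)⁻¹ * x * t ^ k ∈ N := fun _ => Iff.rfl
  have ht : t ∈ Subgroup.normalizer (M : Set E) := by
    rw [Subgroup.mem_normalizer_iff]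
    intro x
    have key : ∀ k : ℕ, (t ^ (k + 1))⁻¹ * (t * x * t⁻¹) * t ^ (k + 1) = (t ^ k)⁻¹ * x * t ^ k :=
      fun k => by rw [pow_succ']; group
    refine ⟨fun ⟨k, hk⟩ => ⟨k + 1, (key k).symm ▸ hk⟩, fun ⟨k, hk⟩ => ⟨k, key k ▸ hadd k 1 _ hk⟩⟩
  have hPM : P ≤ Subgroup.normalizer (M : Set E) := by
    intro p hp
    rw [Subgroup.mem_normalizer_iff]
    intro x
    have key : ∀ k : ℕ, (t ^ k)⁻¹ * (p * x * p⁻¹) * t ^ k = ((t ^ k)⁻¹ * p * t ^ k) *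
        ((t ^ k)⁻¹ * x * t ^ k) * ((t ^ k)⁻¹ * p * t ^ k)⁻¹ := fun k => by group
    refine ⟨fun ⟨k, hk⟩ => ⟨k, key k ▸ hNP _ (hpow hPt k p hp) _ hk⟩, fun ⟨k, hk⟩ => ⟨k, ?_⟩⟩
    rw [key] at hk
    simpa [mul_assoc] using hNP _ (P.inv_mem (hpow hPt k p hp)) _ hk
  refine ⟨M, Subgroup.normalizer_eq_top_iff.1 ?_, hM⟩
  rw [Subgroup.eq_top_iff']
  intro e
  obtain ⟨i, j, p, hp, rfl⟩ := hgen e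
  exact mul_mem (mul_mem (pow_mem ht i) (hPM hp)) (inv_mem (pow_mem ht j))

theorem isVirtuallyPolyZ_of_finite_conj_mem {E : Type*} [Group E] {P : Subgroup E} [Finite P]
    {t : E} (hPt : ∀ p ∈ P, t⁻¹ * p * t ∈ P)
    (hgen : ∀ e : E, ∃ (i j : ℕ), ∃ p ∈ P, e = t ^ i * p * (t ^ j)⁻¹) :
    IsVirtuallyPolyZ E := by
  have ht : t ∈ Subgroup.normalizer (P : Set E) := by
    rw [← inv_mem_iff]
    exact Subgroup.mem_normalizer_fintype fun n hn => by simpa using hPt n hn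
  have hnorm : P.Normal := by
    rw [← Subgroup.normalizer_eq_top_iff, Subgroup.eq_top_iff']
    intro e
    obtain ⟨i, j, p, hp, rfl⟩ := hgen e
    exact mul_mem (mul_mem (pow_mem ht i) (Subgroup.le_normalizer hp)) (inv_mem (pow_mem ht j))
  have : IsCyclic (E ⧸ P) := by
    refine ⟨QuotientGroup.mk t, fun q => ?_⟩
    obtain ⟨e, rfl⟩ := QuotientGroup.mk_surjective q
    obtain ⟨i, j, p, hp, rfl⟩ := hgen e
    rw [QuotientGroup.mk_mul, QuotientGroup.mk_mul, (QuotientGroup.eq_one_iff p).2 hp, mul_one]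
    exact mul_mem (pow_mem (Subgroup.mem_zpowers _) i)
      (inv_mem (pow_mem (Subgroup.mem_zpowers _) j))
  refine .of_ker (QuotientGroup.mk' P) ?_
  rw [QuotientGroup.ker_mk']
  exact .of_finite P

theorem isVirtuallyPolyZ_multiplicative_int : IsVirtuallyPolyZ (Multiplicative ℤ) := by
  refine .of_ker (MonoidHom.id _) ?_
  rw [MonoidHom.ker_id]
  exact .of_finite _

theorem residuallyFinite_of_conj_mem {E : Type*} [Group E] {P : Subgroup E} {t : E}
    (hP : IsVirtuallyPolyZ P) (hPt : ∀ p ∈ P, t⁻¹ * p * t ∈ P)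
    (hgen : ∀ e : E, ∃ (i j : ℕ), ∃ p ∈ P, e = t ^ i * p * (t ^ j)⁻¹)
    (h : E →* Multiplicative ℤ) (hhP : ∀ p ∈ P, h p = 1) (hht : h t = Multiplicative.ofAdd 1) :
    ResiduallyFinite E := by
  intro e he
  by_cases hhe : h e = 1
  swap
  · exact isVirtuallyPolyZ_multiplicative_int.residuallyFinite.exists_of_map_ne_one h hhe
  obtain ⟨i, j, p, hp, rfl⟩ := hgen e
  obtain rfl : i = j := by
    have := congrArg Multiplicative.toAdd hhe
    simp [hhP p hp, hht] at this
    omega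
  let ψ : P →* P := ((MulAut.conj t⁻¹).toMonoidHom.comp P.subtype).codRestrict P fun x => by
    simpa using hPt x x.2
  have hψ : ∀ x : P, ((ψ x : P) : E) = t⁻¹ * x * t := fun x => by simp [ψ]
  have hψinj : Function.Injective ψ := fun x y hxy => by
    have := congrArg Subtype.val hxy
    rw [hψ, hψ] at this
    exact Subtype.ext (by simpa using this)
  have hiter : ∀ (k : ℕ) (x : P), ((ψ^[k] x : P) : E) = (t ^ k)⁻¹ * x * t ^ k := fun k x => by
    induction k with
    | zero => simp
    | succ k ih => rw [Function.iterate_succ_apply', hψ, ih, pow_succ]; group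
  have hp1 : (⟨p, hp⟩ : P) ≠ 1 := by
    rintro hc
    exact he (by simp [show p = 1 from congrArg Subtype.val hc])
  have := hP.fg
  obtain ⟨m, hm⟩ := hP.exists_permCore_notMem hψinj hp1
  obtain ⟨M, hMn, hM⟩ := exists_normal_of_conj_mem (N := (permCore m P).map P.subtype) hPt
    (by
      rintro _ ⟨x, hx, rfl⟩
      exact ⟨ψ x, map_mem_permCore ψ hx, hψ x⟩)
    (by
      rintro q hq _ ⟨x, hx, rfl⟩
      exact ⟨⟨q, hq⟩ * x * ⟨q, hq⟩⁻¹,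
        Subgroup.Normal.conj_mem (H := permCore m P) inferInstance x hx _, rfl⟩) hgen
  have : Finite (P.map (QuotientGroup.mk' M)) := by
    have hle : permCore m P ≤ ((QuotientGroup.mk' M).comp P.subtype).ker := fun x hx =>
      (QuotientGroup.eq_one_iff (x : E)).2 ((hM _).2 ⟨0, x, hx, by simp⟩)
    have hfin := Subgroup.finiteIndex_of_le hle
    have : Finite ((QuotientGroup.mk' M).comp P.subtype).range :=
      Nat.finite_of_card_ne_zero
        (Subgroup.index_ker ((QuotientGroup.mk' M).comp P.subtype) ▸ hfin.index_ne_zero)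
    rwa [MonoidHom.range_comp, P.range_subtype] at this
  have hVP : IsVirtuallyPolyZ (E ⧸ M) := by
    refine isVirtuallyPolyZ_of_finite_conj_mem (P := P.map (QuotientGroup.mk' M))
      (t := QuotientGroup.mk' M t) ?_ ?_
    · rintro _ ⟨x, hx, rfl⟩
      exact ⟨_, hPt x hx, by simp⟩
    · intro q
      obtain ⟨e, rfl⟩ := QuotientGroup.mk'_surjective M q
      obtain ⟨i, j, p, hp, rfl⟩ := hgen e
      exact ⟨i, j, _, ⟨p, hp, rfl⟩, by simp⟩
  refine hVP.residuallyFinite.exists_of_map_ne_one (QuotientGroup.mk' M) fun hc => ?_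
  have hmem : p ∈ M := by
    have := hMn.conj_mem _ ((QuotientGroup.eq_one_iff _).1 hc) (t ^ i)⁻¹
    simpa [mul_assoc] using this
  obtain ⟨k, y, hy, hyk⟩ := (hM p).1 hmem
  exact hm k (Subtype.ext (hyk.trans (hiter k ⟨p, hp⟩).symm) ▸ hy)

theorem IsPolycyclic.isVirtuallyPolyZ_of_finite_ker {G : Type*} {P : Type*} [Group G] [Group P]
    (hG : IsPolycyclic G) (π : P →* G) [Finite π.ker] : IsVirtuallyPolyZ P := by
  obtain ⟨m, H, h0, hlast, hstep⟩ := hG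
  suffices hall : ∀ i, IsVirtuallyPolyZ ((H i).comap π) by
    have := hall (Fin.last m)
    rw [hlast, Subgroup.comap_top] at this
    exact this.of_finiteIndex
  intro i
  induction i using Fin.induction with
  | zero =>
    rw [h0, MonoidHom.comap_bot]
    exact .of_finite _
  | succ i ih =>
    obtain ⟨hle, hn, hcyc⟩ := hstep i
    let f := (QuotientGroup.mk' ((H i.castSucc).subgroupOf (H i.succ))).comp
      (π.subgroupComap (H i.succ))
    refine .of_ker f (ih.of_injective (f := (((H i.succ).comap π).subtype.comp
      f.ker.subtype).codRestrict ((H i.castSucc).comap π) fun x => ?_) fun x y hxy => ?_)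
    · exact (QuotientGroup.eq_one_iff (N := (H i.castSucc).subgroupOf (H i.succ))
        (π.subgroupComap (H i.succ) x.1)).1 x.2
    · have hxy := congrArg Subtype.val hxy
      exact Subtype.ext (Subtype.ext hxy)

namespace AscendingHNNExtension

open HNNExtension

variable {G : Type*} [Group G] (φ : G →* G) (hφ : Function.Injective φ)

theorem inv_t_mul_of_mul_t (g : G) :
    (t⁻¹ * of g * t : AscendingHNNExtension φ hφ) = of (φ g) :=
  (equiv_symm_eq_conj (⟨g, Subgroup.mem_top g⟩ : (⊤ : Subgroup G))).symm

theorem inv_pow_t_mul_of_mul_pow_t (i : ℕ) (g : G) :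
    ((t ^ i)⁻¹ * of g * t ^ i : AscendingHNNExtension φ hφ) = of (φ^[i] g) := by
  induction i with
  | zero => simp
  | succ i ih =>
    rw [Function.iterate_succ_apply', ← inv_t_mul_of_mul_t φ hφ, ← ih, pow_succ]
    group

theorem exists_eq_pow_mul_of_mul_pow (x : AscendingHNNExtension φ hφ) :
    ∃ (i j : ℕ) (g : G), x = t ^ i * of g * (t ^ j)⁻¹ := by
  induction x using HNNExtension.induction_on with
  | of g => exact ⟨0, 0, g, by simp⟩
  | t => exact ⟨1, 0, 1, by simp⟩
  | mul x y hx hy =>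
    obtain ⟨i, j, g, rfl⟩ := hx
    obtain ⟨k, l, h, rfl⟩ := hy
    refine ⟨i + k, l + j, φ^[k] g * φ^[j] h, ?_⟩
    rw [map_mul, ← inv_pow_t_mul_of_mul_pow_t φ hφ, ← inv_pow_t_mul_of_mul_pow_t φ hφ]
    group
  | inv x hx =>
    obtain ⟨i, j, g, rfl⟩ := hx
    exact ⟨j, i, g⁻¹, by simp [mul_assoc]⟩

/-- The homomorphism to `ℤ` that kills the base group and sends the stable letter to `1`. -/
noncomputable def height : AscendingHNNExtension φ hφ →* Multiplicative ℤ :=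
  HNNExtension.lift 1 (Multiplicative.ofAdd 1) fun _ => by simp

end AscendingHNNExtension

/-- If `G` is a polycyclic group and `φ : G → G` is a monomorphism, then the ascending
HNN extension `G_φ` is highly residually finite. -/
theorem statement17 {G : Type*} [Group G] (hpc : IsPolycyclic G) (φ : G →* G)
    (hφ : Function.Injective φ) :
    HighlyResiduallyFinite (AscendingHNNExtension φ hφ) := by
  intro E F _ _ _ ι π hι hπ hker
  have hkerfin : Finite π.ker := by
    rw [hker]
    exact Set.finite_range ι
  obtain ⟨s, hs⟩ := hπ HNNExtension.t
  refine residuallyFinite_of_conj_mem (P := HNNExtension.of.range.comap π) (t := s) ?_ ?_ ?_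
    ((AscendingHNNExtension.height φ hφ).comp π) ?_ ?_
  · let e : G ≃* (HNNExtension.of : G →* AscendingHNNExtension φ hφ).range :=
      MonoidHom.ofInjective (HNNExtension.of_injective _)
    let f := e.symm.toMonoidHom.comp (π.subgroupComap HNNExtension.of.range)
    have : Finite f.ker := by
      refine Finite.of_injective (β := π.ker) (fun x => ⟨x.1.1, ?_⟩) fun x y hxy => ?_
      · have hx : e.symm (π.subgroupComap HNNExtension.of.range x.1) = 1 := x.2
        exact congrArg Subtype.val ((map_eq_one_iff e.symm e.symm.injective).1 hx)
      · have hxy := congrArg Subtype.val hxy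
        exact Subtype.ext (Subtype.ext hxy)
    exact hpc.isVirtuallyPolyZ_of_finite_ker f
  · rintro p ⟨g, hg⟩
    refine ⟨φ g, ?_⟩
    rw [map_mul, map_mul, map_inv, hs, ← hg, AscendingHNNExtension.inv_t_mul_of_mul_t]
  · intro e
    obtain ⟨i, j, g, hg⟩ := AscendingHNNExtension.exists_eq_pow_mul_of_mul_pow φ hφ (π e)
    refine ⟨i, j, (s ^ i)⁻¹ * e * s ^ j, ⟨g, ?_⟩, by group⟩
    simp [hs, hg, mul_assoc]
  · rintro p ⟨g, hg⟩
    rw [MonoidHom.comp_apply, ← hg]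
    simp [AscendingHNNExtension.height]
  · rw [MonoidHom.comp_apply, hs]
    simp [AscendingHNNExtension.height]
end
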